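/- arXiv:2508.17752 — 2 statements merged into one kernel-verified Lean document; each statement's English description precedes it below -/
import Mathlib

section
/- Let g = ĉga_ℓ(1,ℂ) = sl(2,ℂ) ⋉ h, where h is the (2ℓ+2)-dimensional Heisenberg algebra, ℓ ∈ 1/2 + ℕ₀. Then H²(g,g) = 0. -/
noncomputable section

/-- Kronecker delta. -/
def kron {d : ℕ} (i j : Fin d) : ℂ := if i = j then 1 else 0

/-- `IsCGA d N H D C M P` says that the Lie algebra `g`, together with the
distinguished elements `H, D, C`, `M i j` and `P n i` (with `P n i = 0` for `n > N`),
is (a presentation of) the complex conformal Galilei algebra `cga_ℓ(d,ℂ)` with `2ℓ = N`. -/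
structure IsCGA (d N : ℕ) {g : Type*} [LieRing g] [LieAlgebra ℂ g]
    (H D C : g) (M : Fin d → Fin d → g) (P : ℕ → Fin d → g) : Prop where
  skewM : ∀ i j, M j i = - M i j
  bMM : ∀ i j k r, ⁅M i j, M k r⁆ =
      (-(kron i k)) • M j r - (kron j r) • M i k + (kron i r) • M j k + (kron j k) • M i r
  bDH : ⁅D, H⁆ = (2 : ℂ) • H
  bCH : ⁅C, H⁆ = D
  bDC : ⁅D, C⁆ = (-2 : ℂ) • C
  bHM : ∀ i j, ⁅H, M i j⁆ = 0
  bDM : ∀ i j, ⁅D, M i j⁆ = 0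
  bCM : ∀ i j, ⁅C, M i j⁆ = 0
  bMP : ∀ i j k, ∀ n : ℕ, ⁅M i j, P n k⁆ = (-(kron i k)) • P n j + (kron j k) • P n i
  bHP : ∀ n ≤ N, ∀ i, ⁅H, P n i⁆ = (-(n : ℂ)) • P (n - 1) i
  bDP : ∀ n ≤ N, ∀ i, ⁅D, P n i⁆ = ((N : ℂ) - 2 * n) • P n i
  bCP : ∀ n ≤ N, ∀ i, ⁅C, P n i⁆ = ((N : ℂ) - n) • P (n + 1) i
  bPP : ∀ m n : ℕ, ∀ i j, ⁅P m i, P n j⁆ = 0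
  Pbound : ∀ n : ℕ, N < n → ∀ i, P n i = 0
  spans : Submodule.span ℂ
      (({H, D, C} : Set g) ∪ {x | ∃ i j, x = M i j} ∪ {x | ∃ n i, x = P n i}) = ⊤
  dim : Module.finrank ℂ g = d * (d - 1) / 2 + (N + 1) * d + 3

/-- The abelian ideal `V = span{P_{n,i}}`. -/
def VSpan {d : ℕ} {g : Type*} [LieRing g] [LieAlgebra ℂ g]
    (N : ℕ) (P : ℕ → Fin d → g) : Submodule ℂ g :=
  Submodule.span ℂ {x | ∃ n ≤ N, ∃ i, x = P n i}

/-- Structure constants of the mass central extension: `b_m = (-1)^{m+ℓ+1/2}(2ℓ-m)! m!`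
with `2ℓ = N` odd, so `ℓ + 1/2 = (N+1)/2`. -/
def bcoef (N m : ℕ) : ℂ :=
  (-1 : ℂ) ^ (m + (N + 1) / 2) * (N - m).factorial * m.factorial

/-- `IsCGAHat d N H D C M P Mc`: presentation of the mass central extension
`ĉga_ℓ(d,ℂ)` with `2ℓ = N`, central element `Mc`. -/
structure IsCGAHat (d N : ℕ) {g : Type*} [LieRing g] [LieAlgebra ℂ g]
    (H D C : g) (M : Fin d → Fin d → g) (P : ℕ → Fin d → g) (Mc : g) : Prop where
  skewM : ∀ i j, M j i = - M i j
  bMM : ∀ i j k r, ⁅M i j, M k r⁆ =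
      (-(kron i k)) • M j r - (kron j r) • M i k + (kron i r) • M j k + (kron j k) • M i r
  bDH : ⁅D, H⁆ = (2 : ℂ) • H
  bCH : ⁅C, H⁆ = D
  bDC : ⁅D, C⁆ = (-2 : ℂ) • C
  bHM : ∀ i j, ⁅H, M i j⁆ = 0
  bDM : ∀ i j, ⁅D, M i j⁆ = 0
  bCM : ∀ i j, ⁅C, M i j⁆ = 0
  bMP : ∀ i j k, ∀ n : ℕ, ⁅M i j, P n k⁆ = (-(kron i k)) • P n j + (kron j k) • P n i
  bHP : ∀ n ≤ N, ∀ i, ⁅H, P n i⁆ = (-(n : ℂ)) • P (n - 1) i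
  bDP : ∀ n ≤ N, ∀ i, ⁅D, P n i⁆ = ((N : ℂ) - 2 * n) • P n i
  bCP : ∀ n ≤ N, ∀ i, ⁅C, P n i⁆ = ((N : ℂ) - n) • P (n + 1) i
  bPP : ∀ m n : ℕ, ∀ i j, ⁅P m i, P n j⁆ =
      (kron i j * (if m + n = N then bcoef N m else 0)) • Mc
  central : ∀ x : g, ⁅x, Mc⁆ = 0
  Pbound : ∀ n : ℕ, N < n → ∀ i, P n i = 0
  spans : Submodule.span ℂ
      (({H, D, C, Mc} : Set g) ∪ {x | ∃ i j, x = M i j} ∪ {x | ∃ n i, x = P n i}) = ⊤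
  dim : Module.finrank ℂ g = d * (d - 1) / 2 + (N + 1) * d + 4

/-- Adjoint Chevalley–Eilenberg coboundary of a linear `1`-cochain. -/
def cob {g : Type*} [LieRing g] [LieAlgebra ℂ g] (ω : g →ₗ[ℂ] g) (a b : g) : g :=
  ⁅a, ω b⁆ - ⁅b, ω a⁆ - ω ⁅a, b⁆

/-- A `2`-cocycle of a Lie algebra with values in the adjoint module:
an alternating bilinear map satisfying the cocycle identity. -/
structure IsAdCocycle2 {g : Type*} [LieRing g] [LieAlgebra ℂ g] (φ : g → g → g) : Prop where
  addl : ∀ a b c, φ (a + b) c = φ a c + φ b c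
  smull : ∀ (t : ℂ) (a b), φ (t • a) b = t • φ a b
  skew : ∀ a b, φ b a = - φ a b
  cocycle : ∀ a b c,
    ⁅a, φ b c⁆ - ⁅b, φ a c⁆ + ⁅c, φ a b⁆
      - φ ⁅a, b⁆ c + φ ⁅a, c⁆ b - φ ⁅b, c⁆ a = 0

/-- `H²(g,g) = 0`: every adjoint `2`-cocycle is a coboundary. -/
def H2IsTrivial (g : Type*) [LieRing g] [LieAlgebra ℂ g] : Prop :=
  ∀ φ : g → g → g, IsAdCocycle2 φ → ∃ ω : g →ₗ[ℂ] g, ∀ a b, φ a b = cob ω a b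

/-- `H²(g,g) ≅ ℂ`: there is a cocycle which is not a coboundary and which spans
the cocycles modulo coboundaries. -/
def H2Dim1 (g : Type*) [LieRing g] [LieAlgebra ℂ g] : Prop :=
  ∃ ψ : g → g → g, IsAdCocycle2 ψ ∧
    (∀ ω : g →ₗ[ℂ] g, ¬ (∀ a b, ψ a b = cob ω a b)) ∧
    ∀ φ : g → g → g, IsAdCocycle2 φ → ∃ (c : ℂ) (ω : g →ₗ[ℂ] g),
      ∀ a b, φ a b = c • ψ a b + cob ω a b

/-- `dim H²(g,g) = 2`. -/
def H2Dim2 (g : Type*) [LieRing g] [LieAlgebra ℂ g] : Prop :=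
  ∃ ψ₁ ψ₂ : g → g → g, IsAdCocycle2 ψ₁ ∧ IsAdCocycle2 ψ₂ ∧
    (∀ c₁ c₂ : ℂ, (∃ ω : g →ₗ[ℂ] g, ∀ a b, c₁ • ψ₁ a b + c₂ • ψ₂ a b = cob ω a b) →
      c₁ = 0 ∧ c₂ = 0) ∧
    ∀ φ : g → g → g, IsAdCocycle2 φ → ∃ (c₁ c₂ : ℂ) (ω : g →ₗ[ℂ] g),
      ∀ a b, φ a b = c₁ • ψ₁ a b + c₂ • ψ₂ a b + cob ω a b

namespace Sl2Rep

open Module.End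

variable {W : Type*} [AddCommGroup W] [Module ℂ W]

/-- The Casimir element (normalised as `h² + 2h + 4fe`) of an `sl₂`-triple of endomorphisms. -/
def casimir (e f h : Module.End ℂ W) : Module.End ℂ W := h * h + 2 * h + 4 * (f * e)

theorem eq_zero_of_sub_pow_apply_eq_zero {h : Module.End ℂ W} {ν : ℂ}
    (hν : ¬ h.HasEigenvalue ν) (k : ℕ) {x : W} (hx : ((h - ν • 1) ^ k) x = 0) : x = 0 := by
  induction k with
  | zero => simpa using hx
  | succ k ih =>
    refine ih ?_
    by_contra hne
    refine hν (hasEigenvalue_of_hasEigenvector ⟨mem_eigenspace_iff.2 ?_, hne⟩)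
    rw [pow_succ', Module.End.mul_apply] at hx
    simpa [sub_eq_zero] using hx

theorem re_eigenvalue_nonpos [FiniteDimensional ℂ W] {e f h : Module.End ℂ W}
    (he : h * e - e * h = 2 * e) (hΩ : IsNilpotent (casimir e f h))
    {μ : ℂ} (hμ : h.HasEigenvalue μ) : μ.re ≤ 0 := by
  obtain ⟨ν, hν, hmax⟩ := Set.exists_max_image {μ | h.HasEigenvalue μ} Complex.re
    (finite_hasEigenvalue h) ⟨μ, hμ⟩
  refine (hmax μ hμ).trans ?_
  obtain ⟨v, hv⟩ := HasEigenvalue.exists_hasEigenvector hν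
  have hhv : h v = ν • v := hv.apply_eq_smul
  have hev : e v = 0 := by
    by_contra hne
    have h1 : h (e v) = (ν + 2) • e v := by
      have := LinearMap.congr_fun he v
      simp only [LinearMap.sub_apply, Module.End.mul_apply, hhv, map_smul,
        Module.End.ofNat_apply, sub_eq_iff_eq_add] at this
      rw [this]
      module
    have h2 := hmax (ν + 2) (hasEigenvalue_of_hasEigenvector ⟨mem_eigenspace_iff.2 h1, hne⟩)
    norm_num at h2
  have hc : casimir e f h v = (ν * (ν + 2)) • v := by
    simp only [casimir, LinearMap.add_apply, Module.End.mul_apply, hhv, map_smul, hev, map_zero,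
      Module.End.ofNat_apply]
    module
  obtain ⟨k, hk⟩ := hΩ
  have hp : ∀ n : ℕ, (casimir e f h ^ n) v = (ν * (ν + 2)) ^ n • v := by
    intro n
    induction n with
    | zero => simp
    | succ n ih => rw [pow_succ, Module.End.mul_apply, hc, map_smul, ih, smul_smul, pow_succ']
  have h0 := hp k
  rw [hk, LinearMap.zero_apply, eq_comm, smul_eq_zero] at h0
  rcases mul_eq_zero.1 (eq_zero_of_pow_eq_zero (h0.resolve_right hv.2)) with h0 | h0
  · simp [h0]
  · simp [eq_neg_of_add_eq_zero_left h0]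

theorem raising_eq_zero [FiniteDimensional ℂ W] {e h : Module.End ℂ W}
    (he : h * e - e * h = 2 * e) (hre : ∀ μ, h.HasEigenvalue μ → μ.re = 0) : e = 0 := by
  have key : (⊤ : Submodule ℂ W) ≤ LinearMap.ker e := by
    rw [← iSup_maxGenEigenspace_eq_top h, iSup_le_iff]
    intro μ v hv
    obtain ⟨k, hk⟩ := (mem_maxGenEigenspace h μ v).1 hv
    rw [LinearMap.mem_ker]
    by_cases hμ : h.HasEigenvalue μ
    · have hsemi : SemiconjBy e (h - μ • 1) (h - (μ + 2) • 1) := by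
        rw [SemiconjBy, mul_sub, sub_mul, sub_eq_iff_eq_add.1 he, add_smul]
        ext x
        simp
        module
      refine eq_zero_of_sub_pow_apply_eq_zero (h := h) (ν := μ + 2) (fun h2 => ?_) k
        (x := e v) ?_
      · have := hre _ h2
        simp [hre _ hμ] at this
      · have := LinearMap.congr_fun (hsemi.pow_right k).eq v
        rw [Module.End.mul_apply, Module.End.mul_apply, hk, map_zero] at this
        exact this.symm
    · rw [eq_zero_of_sub_pow_apply_eq_zero hμ k hk, map_zero]
  ext v
  exact key (Submodule.mem_top : v ∈ ⊤)

theorem eq_zero_of_isNilpotent_casimir [FiniteDimensional ℂ W] {e f h : Module.End ℂ W}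
    (he : h * e - e * h = 2 * e) (hf : h * f - f * h = -(2 * f)) (hef : e * f - f * e = h)
    (hΩ : IsNilpotent (casimir e f h)) : e = 0 ∧ f = 0 ∧ h = 0 := by
  have hf' : (-h) * f - f * (-h) = 2 * f := by
    rw [← neg_eq_iff_eq_neg] at hf
    rw [← hf]; noncomm_ring
  have hΩ' : casimir f e (-h) = casimir e f h := by
    have : casimir f e (-h) - casimir e f h = 4 * ((e * f - f * e) - h) := by
      unfold casimir; noncomm_ring
    rwa [hef, sub_self, mul_zero, sub_eq_zero] at this
  have hneg : ∀ μ, h.HasEigenvalue μ → (-h).HasEigenvalue (-μ) := by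
    intro μ hμ
    obtain ⟨v, hv⟩ := HasEigenvalue.exists_hasEigenvector hμ
    exact hasEigenvalue_of_hasEigenvector
      ⟨mem_eigenspace_iff.2 (by simp [hv.apply_eq_smul]), hv.2⟩
  have hre : ∀ μ, h.HasEigenvalue μ → μ.re = 0 := fun μ hμ =>
    le_antisymm (re_eigenvalue_nonpos he hΩ hμ)
      (by simpa using re_eigenvalue_nonpos hf' (hΩ'.symm ▸ hΩ) (hneg μ hμ))
  have e0 : e = 0 := raising_eq_zero he hre
  have f0 : f = 0 := raising_eq_zero hf' fun μ hμ => by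
    obtain ⟨v, hv⟩ := HasEigenvalue.exists_hasEigenvector hμ
    have : h v = (-μ) • v := by
      rw [neg_smul, ← hv.apply_eq_smul]; simp
    simpa using hre (-μ) (hasEigenvalue_of_hasEigenvector ⟨mem_eigenspace_iff.2 this, hv.2⟩)
  exact ⟨e0, f0, by rw [← hef, e0, f0]; simp⟩

theorem commute_casimir {e f h : Module.End ℂ W}
    (he : h * e - e * h = 2 * e) (hf : h * f - f * h = -(2 * f)) (hef : e * f - f * e = h) :
    Commute (casimir e f h) e ∧ Commute (casimir e f h) f ∧ Commute (casimir e f h) h := by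
  have r₁ : h * e - e * h - 2 * e = 0 := by rw [he, sub_self]
  have r₂ : e * f - f * e - h = 0 := by rw [hef, sub_self]
  have r₃ : h * f - f * h + 2 * f = 0 := by rw [hf, neg_add_cancel]
  refine ⟨?_, ?_, ?_⟩
  · have : casimir e f h * e - e * casimir e f h =
        h * (h * e - e * h - 2 * e) + (h * e - e * h - 2 * e) * h
          - 4 * ((e * f - f * e - h) * e) := by
      unfold casimir; noncomm_ring
    rw [r₁, r₂] at this
    exact sub_eq_zero.1 (by simpa using this)
  · have : casimir e f h * f - f * casimir e f h =
        h * (h * f - f * h + 2 * f) + (h * f - f * h + 2 * f) * h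
          + 4 * (f * (e * f - f * e - h)) := by
      unfold casimir; noncomm_ring
    rw [r₃, r₂] at this
    exact sub_eq_zero.1 (by simpa using this)
  · have : casimir e f h * h - h * casimir e f h =
        -(4 * ((h * f - f * h + 2 * f) * e + f * (h * e - e * h - 2 * e))) := by
      unfold casimir; noncomm_ring
    rw [r₁, r₃] at this
    exact sub_eq_zero.1 (by simpa using this)

/-- A finite-dimensional representation of `sl₂` is the sum of its image under `sl₂` and its
subspace of invariants. -/
theorem exists_eq_image_add_invariant [FiniteDimensional ℂ W] {e f h : Module.End ℂ W}
    (he : ∀ x, h (e x) - e (h x) = (2 : ℂ) • e x)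
    (hf : ∀ x, h (f x) - f (h x) = (-2 : ℂ) • f x) (hef : ∀ x, e (f x) - f (e x) = h x) (z : W) :
    ∃ a b c w, z = e a + f b + h c + w ∧ e w = 0 ∧ f w = 0 ∧ h w = 0 := by
  replace he : h * e - e * h = 2 * e := by
    ext x; simpa [two_smul] using he x
  replace hf : h * f - f * h = -(2 * f) := by
    ext x; simpa [two_smul] using hf x
  replace hef : e * f - f * e = h := LinearMap.ext hef
  obtain ⟨ce, cf, ch⟩ := commute_casimir he hf hef
  set Ω := casimir e f h with hΩdef
  obtain ⟨n, hn, hn1⟩ := (Ω.eventually_isCompl_ker_pow_range_pow.and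
    (Filter.eventually_ge_atTop 1)).exists
  have hst : ∀ {u : Module.End ℂ W}, Commute Ω u →
      ∀ x ∈ LinearMap.ker (Ω ^ n), u x ∈ LinearMap.ker (Ω ^ n) := by
    intro u hu x hx
    rw [LinearMap.mem_ker] at hx ⊢
    rw [← Module.End.mul_apply, (hu.pow_left n).eq, Module.End.mul_apply, hx, map_zero]
  obtain ⟨e0, f0, h0⟩ := eq_zero_of_isNilpotent_casimir
    (W := LinearMap.ker (Ω ^ n)) (e := e.restrict (hst ce)) (f := f.restrict (hst cf))
    (h := h.restrict (hst ch))
    (by ext x; simpa using LinearMap.congr_fun he (x : W))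
    (by ext x; simpa using LinearMap.congr_fun hf (x : W))
    (by ext x; simpa using LinearMap.congr_fun hef (x : W))
    ⟨n, by
      have hΩ : casimir (e.restrict (hst ce)) (f.restrict (hst cf)) (h.restrict (hst ch)) =
          Ω.restrict (hst (Commute.refl Ω)) := by
        ext x
        simp [hΩdef, casimir]
      rw [hΩ, Module.End.pow_restrict]
      ext x
      simp⟩
  obtain ⟨w, hw, r, ⟨y, rfl⟩, rfl⟩ := Submodule.mem_sup.1
    ((hn.sup_eq_top ▸ Submodule.mem_top : z ∈ LinearMap.ker (Ω ^ n) ⊔ LinearMap.range (Ω ^ n)))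
  obtain ⟨m, rfl⟩ := Nat.exists_eq_add_of_le' hn1
  have hzero : ∀ {u : Module.End ℂ W} (hu : Commute Ω u), u.restrict (hst hu) = 0 → u w = 0 := by
    intro u hu h0
    simpa using congrArg Subtype.val (LinearMap.congr_fun h0 ⟨w, hw⟩)
  set x := (Ω ^ m) y
  refine ⟨0, (4 : ℂ) • e x, h x + (2 : ℂ) • x, w, ?_, hzero ce e0, hzero cf f0, hzero ch h0⟩
  rw [pow_succ', Module.End.mul_apply]
  change w + Ω x = _
  clear_value x
  simp only [hΩdef, casimir, LinearMap.add_apply, Module.End.mul_apply, Module.End.ofNat_apply,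
    map_add, map_smul, map_zero]
  module

end Sl2Rep

namespace AdjointCohomology

section Cocycle

variable {g : Type*} [LieRing g] [LieAlgebra ℂ g]

/-- The space of adjoint `2`-cocycles. -/
def cocycles (g : Type*) [LieRing g] [LieAlgebra ℂ g] : Submodule ℂ (g →ₗ[ℂ] g →ₗ[ℂ] g) where
  carrier := {φ | (∀ x y, φ y x = -φ x y) ∧ ∀ x y z,
    ⁅x, φ y z⁆ - ⁅y, φ x z⁆ + ⁅z, φ x y⁆ - φ ⁅x, y⁆ z + φ ⁅x, z⁆ y - φ ⁅y, z⁆ x = 0}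
  add_mem' := by
    rintro φ ψ ⟨h1, h2⟩ ⟨h3, h4⟩
    refine ⟨fun x y => ?_, fun x y z => ?_⟩
    · simp only [LinearMap.add_apply, h1 x, h3 x, neg_add]
    · rw [← add_zero (0 : g)]
      nth_rw 1 [← h2 x y z]
      rw [← h4 x y z]
      simp only [LinearMap.add_apply, lie_add]
      abel
  zero_mem' := by simp
  smul_mem' := by
    rintro t φ ⟨h1, h2⟩
    refine ⟨fun x y => ?_, fun x y z => ?_⟩
    · simp only [LinearMap.smul_apply, h1 x, smul_neg]
    · rw [← smul_zero t, ← h2 x y z]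
      simp only [LinearMap.smul_apply, lie_smul, smul_add, smul_sub]

/-- The coboundary of `1`-cochains, as a linear map. -/
def coboundary : (g →ₗ[ℂ] g) →ₗ[ℂ] g →ₗ[ℂ] g →ₗ[ℂ] g where
  toFun ω := LinearMap.mk₂ ℂ (fun a b => cob ω a b)
    (fun _ _ _ => by simp [cob]; abel) (fun _ _ _ => by simp [cob, smul_sub])
    (fun _ _ _ => by simp [cob]; abel) (fun _ _ _ => by simp [cob, smul_sub])
  map_add' _ _ := by ext; simp [cob]; abel
  map_smul' _ _ := by ext; simp [cob, smul_sub]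

theorem coboundary_apply (ω : g →ₗ[ℂ] g) (a b : g) :
    coboundary ω a b = ⁅a, ω b⁆ - ⁅b, ω a⁆ - ω ⁅a, b⁆ := rfl

theorem coboundary_mem_cocycles (ω : g →ₗ[ℂ] g) : coboundary ω ∈ cocycles g := by
  refine ⟨fun x y => ?_, fun x y z => ?_⟩
  · rw [coboundary_apply, coboundary_apply, ← lie_skew x y, map_neg]
    abel
  · simp only [coboundary_apply, lie_sub, lie_lie, ← lie_skew x ⁅y, z⁆, ← lie_skew y ⁅x, z⁆,
      map_neg, map_sub]
    rw [leibniz_lie y x, leibniz_lie z x, leibniz_lie z y]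
    simp only [lie_lie, ← lie_skew x z, ← lie_skew y z, ← lie_skew x y, lie_neg, map_neg]
    abel

/-- The coboundary of an inner derivation vanishes. -/
theorem coboundary_toEnd (u : g) : coboundary (LieModule.toEnd ℂ g g u) = 0 := by
  ext a b
  rw [coboundary_apply]
  simp only [LieModule.toEnd_apply_apply, LinearMap.zero_apply]
  rw [leibniz_lie u a b, ← lie_skew b ⁅u, a⁆]
  abel

/-- The Lie derivative `d ∘ ι_x` on `2`-cocycles. -/
def lieDeriv : g →ₗ[ℂ] Module.End ℂ (cocycles g) :=
  LinearMap.mk₂ ℂ (fun x φ => ⟨coboundary (φ.1 x), coboundary_mem_cocycles (φ.1 x)⟩)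
    (fun x y φ => Subtype.ext (by simp))
    (fun t x φ => Subtype.ext (by simp))
    (fun x φ ψ => Subtype.ext (by simp))
    (fun t x φ => Subtype.ext (by simp))

theorem lieDeriv_apply_apply (x : g) (φ : cocycles g) (a b : g) :
    (lieDeriv x φ).1 a b = ⁅a, φ.1 x b⁆ - ⁅b, φ.1 x a⁆ - φ.1 x ⁅a, b⁆ := rfl

theorem contraction_lieDeriv_sub (x y z : g) (φ : cocycles g) :
    (lieDeriv y φ).1 x z - (lieDeriv x φ).1 y z = φ.1 ⁅x, y⁆ z - ⁅φ.1 x y, z⁆ := by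
  have h := φ.2.2 x y z
  rw [φ.2.1 y ⁅x, z⁆, φ.2.1 x ⁅y, z⁆] at h
  rw [lieDeriv_apply_apply, lieDeriv_apply_apply, φ.2.1 x y, lie_neg, lie_skew,
    ← lie_skew z (φ.1 x y)]
  rw [← lie_skew z (φ.1 x y)] at h
  rw [← sub_eq_zero, ← h]
  abel

theorem lieDeriv_lie (x y : g) (φ : cocycles g) :
    lieDeriv x (lieDeriv y φ) - lieDeriv y (lieDeriv x φ) = lieDeriv ⁅x, y⁆ φ := by
  apply Subtype.ext
  have h : (lieDeriv y φ).1 x - (lieDeriv x φ).1 y =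
      φ.1 ⁅x, y⁆ - LieModule.toEnd ℂ g g (φ.1 x y) := by
    ext z
    exact contraction_lieDeriv_sub x y z φ
  have := congrArg coboundary h
  rwa [map_sub, map_sub, coboundary_toEnd, sub_zero] at this

theorem apply_lie_eq {φ : cocycles g} {x y : g} (hx : lieDeriv x φ = 0)
    (hy : lieDeriv y φ = 0) (z : g) : φ.1 ⁅x, y⁆ z = ⁅φ.1 x y, z⁆ := by
  have := contraction_lieDeriv_sub x y z φ
  rw [hx, hy] at this
  exact (sub_eq_zero.1 (this.symm.trans (sub_self _)))

theorem lie_apply_of_apply_eq_zero {φ : cocycles g} {x : g} (hx : φ.1 x = 0) (a b : g) :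
    ⁅x, φ.1 a b⁆ = φ.1 ⁅x, a⁆ b + φ.1 a ⁅x, b⁆ := by
  have h := φ.2.2 x a b
  rw [φ.2.1 a ⁅x, b⁆, φ.2.1 x ⁅a, b⁆, hx] at h
  simp only [LinearMap.zero_apply, lie_zero, neg_zero, sub_zero, add_zero] at h
  rw [← sub_eq_zero, ← h]
  abel

/-- Modulo coboundaries every `2`-cocycle is invariant under a given `sl₂`. -/
theorem exists_coboundary_add_invariant [FiniteDimensional ℂ g] {H D C : g}
    (hDH : ⁅D, H⁆ = (2 : ℂ) • H) (hCH : ⁅C, H⁆ = D) (hDC : ⁅D, C⁆ = (-2 : ℂ) • C)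
    (φ : cocycles g) :
    ∃ (ω : g →ₗ[ℂ] g) (ψ : cocycles g), φ.1 = coboundary ω + ψ.1 ∧
      lieDeriv H ψ = 0 ∧ lieDeriv D ψ = 0 ∧ lieDeriv C ψ = 0 := by
  obtain ⟨α, β, γ, ψ, h, h1, h2, h3⟩ := Sl2Rep.exists_eq_image_add_invariant
    (e := lieDeriv H) (f := lieDeriv (-C)) (h := lieDeriv D)
    (fun ψ => by rw [lieDeriv_lie, hDH, map_smul, LinearMap.smul_apply])
    (fun ψ => by rw [lieDeriv_lie, lie_neg, hDC, ← smul_neg, map_smul, LinearMap.smul_apply])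
    (fun ψ => by rw [lieDeriv_lie, lie_neg, lie_skew, hCH]) φ
  refine ⟨α.1 H + β.1 (-C) + γ.1 D, ψ, ?_, h1, h3, ?_⟩
  · rw [h, map_add, map_add]
    rfl
  · rw [← neg_one_smul ℂ C, map_smul, LinearMap.smul_apply] at h2
    exact (smul_eq_zero.1 h2).resolve_left (by norm_num)

end Cocycle

section ConformalGalilei

variable {N : ℕ} {g : Type*} [LieRing g] [LieAlgebra ℂ g] {H D C Mc : g}
  {M : Fin 1 → Fin 1 → g} {P : ℕ → Fin 1 → g}

theorem eq_zero_of_eq_neg {V : Type*} [AddCommGroup V] [Module ℂ V] {x : V} (h : x = -x) :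
    x = 0 := by
  have h2 : (2 : ℂ) • x = 0 := by rw [two_smul, ← eq_neg_iff_add_eq_zero, ← h]
  exact (smul_eq_zero.1 h2).resolve_left two_ne_zero

theorem bcoef_ne_zero (N m : ℕ) : bcoef N m ≠ 0 := by
  unfold bcoef
  exact mul_ne_zero (mul_ne_zero (pow_ne_zero _ (by norm_num))
    (Nat.cast_ne_zero.2 (Nat.factorial_ne_zero _))) (Nat.cast_ne_zero.2 (Nat.factorial_ne_zero _))

/-- The weights of `D` on the standard basis `H, D, C, Mc, P₀, …, P_N`. -/
def weight (N : ℕ) : Fin 4 ⊕ Fin (N + 1) → ℂ :=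
  Sum.elim ![2, 0, -2, 0] (fun i => (N : ℂ) - 2 * (i : ℕ))

/-- The standard basis `H, D, C, Mc, P₀, …, P_N` as a family. -/
def stdFamily (N : ℕ) (H D C Mc : g) (P : ℕ → Fin 1 → g) : Fin 4 ⊕ Fin (N + 1) → g :=
  Sum.elim ![H, D, C, Mc] (fun i => P i 0)

theorem lie_mass (hg : IsCGAHat 1 N H D C M P Mc) (x : g) : ⁅Mc, x⁆ = 0 := by
  rw [← lie_skew, hg.central, neg_zero]

theorem lie_momentum (hg : IsCGAHat 1 N H D C M P Mc) (i j : ℕ) :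
    ⁅P i 0, P j 0⁆ = (if i + j = N then bcoef N i else 0) • Mc := by
  simp [hg.bPP, kron]

theorem finiteDimensional (hg : IsCGAHat 1 N H D C M P Mc) : FiniteDimensional ℂ g :=
  Module.finite_of_finrank_pos (by rw [hg.dim]; omega)

theorem exists_basis (hg : IsCGAHat 1 N H D C M P Mc) :
    ∃ b : Module.Basis (Fin 4 ⊕ Fin (N + 1)) ℂ g, ⇑b = stdFamily N H D C Mc P := by
  have hspan : ⊤ ≤ Submodule.span ℂ (Set.range (stdFamily N H D C Mc P)) := by
    rw [← hg.spans, Submodule.span_le]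
    rintro x ((hx | ⟨i, j, rfl⟩) | ⟨n, i, rfl⟩)
    · apply Submodule.subset_span
      simp only [Set.mem_insert_iff, Set.mem_singleton_iff] at hx
      rcases hx with rfl | rfl | rfl | rfl
      exacts [⟨.inl 0, rfl⟩, ⟨.inl 1, rfl⟩, ⟨.inl 2, rfl⟩, ⟨.inl 3, rfl⟩]
    · have hM : M i j = 0 := by
        have := hg.skewM i j
        rw [Subsingleton.elim j i] at this ⊢
        exact eq_zero_of_eq_neg (V := g) this
      simp [hM]
    · rw [Subsingleton.elim i 0]
      rcases le_or_gt n N with hn | hn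
      · exact Submodule.subset_span ⟨.inr ⟨n, by omega⟩, rfl⟩
      · simp [hg.Pbound n hn]
  have hcard : Fintype.card (Fin 4 ⊕ Fin (N + 1)) = Module.finrank ℂ g := by
    rw [hg.dim]
    simp
    omega
  exact ⟨basisOfTopLeSpanOfCardEqFinrank _ hspan hcard,
    coe_basisOfTopLeSpanOfCardEqFinrank _ hspan hcard⟩

/-- Skew-symmetry propagates a vanishing raising relation along an even antidiagonal. -/
theorem eq_zero_of_even_antidiagonal {V : Type*} [AddCommGroup V] [Module ℂ V] {Y : ℕ → ℕ → V}
    (hskew : ∀ i j, Y j i = -Y i j) {r : ℕ}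
    (hrel : ∀ i j, i ≤ N → j ≤ N → i + j + 1 = 2 * r →
      ((N : ℂ) - i) • Y (i + 1) j + ((N : ℂ) - j) • Y i (j + 1) = 0)
    {i j : ℕ} (hi : i ≤ N) (hj : j ≤ N) (hij : i + j = 2 * r) : Y i j = 0 := by
  have key : ∀ k, k ≤ r → r + k ≤ N → Y (r + k) (r - k) = 0 := by
    intro k
    induction k with
    | zero => exact fun _ _ => eq_zero_of_eq_neg (hskew r r)
    | succ k ih =>
      intro hk hkN
      have h := hrel (r + k) (r - (k + 1)) (by omega) (by omega) (by omega)
      rw [show r - (k + 1) + 1 = r - k by omega, ih (by omega) (by omega), smul_zero, add_zero,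
        smul_eq_zero] at h
      refine h.resolve_left ?_
      rw [sub_eq_zero, Nat.cast_inj]
      omega
  rcases le_total i j with h | h
  · rw [hskew j i, neg_eq_zero, ← key (j - r) (by omega) (by omega)]
    congr 1 <;> omega
  · rw [← key (i - r) (by omega) (by omega)]
    congr 1 <;> omega

section Basis

variable {b : Module.Basis (Fin 4 ⊕ Fin (N + 1)) ℂ g}

theorem lie_basis (hg : IsCGAHat 1 N H D C M P Mc) (hb : ⇑b = stdFamily N H D C Mc P)
    (k : Fin 4 ⊕ Fin (N + 1)) : ⁅D, b k⁆ = weight N k • b k := by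
  rw [hb]
  rcases k with k | k
  · fin_cases k
    · exact hg.bDH
    · simp [stdFamily, weight]
    · exact hg.bDC
    · simp [stdFamily, weight, hg.central]
  · exact hg.bDP k (by omega) 0

theorem repr_eq_zero_of_lie_eq_smul (hg : IsCGAHat 1 N H D C M P Mc)
    (hb : ⇑b = stdFamily N H D C Mc P) {y : g} {κ : ℂ} (hy : ⁅D, y⁆ = κ • y)
    {k : Fin 4 ⊕ Fin (N + 1)} (hk : κ ≠ weight N k) : b.repr y k = 0 := by
  have h : b.coord k ∘ₗ LieModule.toEnd ℂ g g D = weight N k • b.coord k := by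
    refine b.ext fun j => ?_
    simp only [LinearMap.comp_apply, LieModule.toEnd_apply_apply, lie_basis hg hb, map_smul,
      LinearMap.smul_apply, Module.Basis.coord_apply, Module.Basis.repr_self, smul_eq_mul,
      Finsupp.single_apply]
    split_ifs with hjk
    · rw [hjk]
    · simp
  have h' := LinearMap.congr_fun h y
  simp only [LinearMap.comp_apply, LieModule.toEnd_apply_apply, hy, map_smul,
      LinearMap.smul_apply, Module.Basis.coord_apply, smul_eq_mul] at h'
  exact (mul_eq_mul_right_iff.1 h').resolve_left hk

theorem two_mul_ne_weight_momentum (hN : Odd N) (t : ℤ) (i : ℕ) :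
    (2 * t : ℂ) ≠ (N : ℂ) - 2 * i := by
  intro h
  have h' : 2 * t = (N : ℤ) - 2 * i := by exact_mod_cast h
  obtain ⟨m, rfl⟩ := hN
  omega

theorem eq_zero_of_lie_eq_smul (hN : Odd N) (hg : IsCGAHat 1 N H D C M P Mc)
    (hb : ⇑b = stdFamily N H D C Mc P) {y : g} {t : ℤ} (hy : ⁅D, y⁆ = (2 * t : ℂ) • y)
    (h₁ : t ≠ 1) (h₀ : t ≠ 0) (h₂ : t ≠ -1) : y = 0 := by
  refine b.ext_elem fun k => ?_
  rw [map_zero, Finsupp.zero_apply]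
  refine repr_eq_zero_of_lie_eq_smul hg hb hy ?_
  rcases k with k | k
  · fin_cases k
    · intro h
      simp only [weight, Sum.elim_inl] at h
      exact h₁ (by have : (2 * t : ℂ) = (2 : ℤ) := by simpa using h
                   norm_cast at this; omega)
    · intro h
      exact h₀ (by simpa [weight] using h)
    · intro h
      exact h₂ (by have : (2 * t : ℂ) = (-2 : ℤ) := by simpa [weight] using h
                   norm_cast at this; omega)
    · intro h
      exact h₀ (by simpa [weight] using h)
  · exact two_mul_ne_weight_momentum hN t k

theorem eq_smul_mass (hN : Odd N) (hg : IsCGAHat 1 N H D C M P Mc)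
    (hb : ⇑b = stdFamily N H D C Mc P) {y : g} (hD : ⁅D, y⁆ = 0) (hH : ⁅H, y⁆ = 0) :
    ∃ c : ℂ, y = c • Mc := by
  have hz : ∀ k, weight N k ≠ 0 → b.repr y k = 0 := fun k hk =>
    repr_eq_zero_of_lie_eq_smul hg hb (κ := 0) (by rw [hD, zero_smul]) hk.symm
  have hsum : y = b.repr y (.inl 1) • D + b.repr y (.inl 3) • Mc := by
    conv_lhs => rw [← b.sum_repr y]
    rw [Fintype.sum_sum_type, Fin.sum_univ_four, hz (.inl 0) (by simp [weight]),
      hz (.inl 2) (by simp [weight]), Finset.sum_eq_zero, hb]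
    · simp [stdFamily]
    · intro k _
      rw [hz, zero_smul]
      simpa [weight] using (two_mul_ne_weight_momentum hN 0 k).symm
  have hH0 : H ≠ 0 := by
    have := b.ne_zero (.inl 0)
    rwa [hb] at this
  rw [hsum, lie_add, lie_smul, lie_smul, hg.central, ← lie_skew, hg.bDH, smul_zero, add_zero,
    ← neg_smul, smul_smul, smul_eq_zero] at hH
  have hd : b.repr y (.inl 1) = 0 := by simpa using hH.resolve_right hH0
  exact ⟨_, by rw [hsum, hd, zero_smul, zero_add]⟩

theorem eq_smul_momentum (hN : Odd N) (hg : IsCGAHat 1 N H D C M P Mc)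
    (hb : ⇑b = stdFamily N H D C Mc P) {y : g} {i : ℕ} (hi : i ≤ N)
    (hD : ⁅D, y⁆ = ((N : ℂ) - 2 * i) • y) : ∃ c : ℂ, y = c • P i 0 := by
  refine ⟨b.repr y (.inr ⟨i, by omega⟩), ?_⟩
  conv_lhs => rw [← b.sum_repr y]
  have h4 : ∀ k : Fin 4, b.repr y (.inl k) = 0 := by
    intro k
    refine repr_eq_zero_of_lie_eq_smul hg hb hD fun h => ?_
    fin_cases k
    · exact two_mul_ne_weight_momentum hN 1 i (by simpa [weight] using h.symm)
    · exact two_mul_ne_weight_momentum hN 0 i (by simpa [weight] using h.symm)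
    · exact two_mul_ne_weight_momentum hN (-1) i (by simpa [weight] using h.symm)
    · exact two_mul_ne_weight_momentum hN 0 i (by simpa [weight] using h.symm)
  rw [Fintype.sum_sum_type, Finset.sum_eq_zero (fun k _ => by rw [h4, zero_smul]), zero_add,
    Finset.sum_eq_single (⟨i, by omega⟩ : Fin (N + 1)), hb]
  · rfl
  · intro k _ hk
    rw [repr_eq_zero_of_lie_eq_smul hg hb hD, zero_smul]
    intro h
    refine hk (Fin.ext ?_)
    have : (N : ℂ) - 2 * i = (N : ℂ) - 2 * (k : ℕ) := h
    have h' : (N : ℤ) - 2 * i = (N : ℤ) - 2 * (k : ℕ) := by exact_mod_cast this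
    change (k : ℕ) = i
    omega
  · simp

theorem linearMap_ext_std (hb : ⇑b = stdFamily N H D C Mc P) {V : Type*} [AddCommGroup V]
    [Module ℂ V] {L L' : g →ₗ[ℂ] V} (hH : L H = L' H) (hD : L D = L' D) (hC : L C = L' C)
    (hM : L Mc = L' Mc) (hP : ∀ i ≤ N, L (P i 0) = L' (P i 0)) : L = L' := by
  refine b.ext fun k => ?_
  rw [hb]
  rcases k with k | k
  · fin_cases k
    exacts [hH, hD, hC, hM]
  · exact hP k (by omega)

theorem exists_linearMap_std (hg : IsCGAHat 1 N H D C M P Mc)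
    (hb : ⇑b = stdFamily N H D C Mc P) (uH uD uC uM : g) :
    ∃ ω : g →ₗ[ℂ] g, ω H = uH ∧ ω D = uD ∧ ω C = uC ∧ ω Mc = uM ∧ ∀ i, ω (P i 0) = 0 := by
  have h : ∀ k, b.constr ℂ (Sum.elim ![uH, uD, uC, uM] 0) (stdFamily N H D C Mc P k) =
      (Sum.elim ![uH, uD, uC, uM] 0 : _ → g) k := fun k => by
    rw [← hb, b.constr_basis]
  refine ⟨_, h (.inl 0), h (.inl 1), h (.inl 2), h (.inl 3), fun i => ?_⟩
  rcases le_or_gt i N with hi | hi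
  · exact h (.inr ⟨i, by omega⟩)
  · rw [hg.Pbound i hi, map_zero]

/-- An `sl₂`-invariant cocycle is cohomologous to one that vanishes on `sl₂`. -/
theorem exists_coboundary_eq_on_sl2 (hg : IsCGAHat 1 N H D C M P Mc)
    (hb : ⇑b = stdFamily N H D C Mc P) {ψ : cocycles g} (hH : lieDeriv H ψ = 0)
    (hD : lieDeriv D ψ = 0) (hC : lieDeriv C ψ = 0) :
    ∃ ω : g →ₗ[ℂ] g, ψ.1 H = coboundary ω H ∧ ψ.1 D = coboundary ω D ∧
      ψ.1 C = coboundary ω C := by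
  obtain ⟨ω, ωH, ωD, ωC, ωM, ωP⟩ := exists_linearMap_std hg hb ((1 / 2 : ℂ) • ψ.1 D H)
    (ψ.1 C H) ((-1 / 2 : ℂ) • ψ.1 D C) 0
  have hself : ∀ x, ψ.1 x x = 0 := fun x => eq_zero_of_eq_neg (ψ.2.1 x x)
  have hxH : ∀ z, ψ.1 H z = ⁅ω H, z⁆ := fun z => by
    have h := apply_lie_eq hD hH z
    rw [hg.bDH, map_smul, LinearMap.smul_apply] at h
    rw [ωH, smul_lie, ← h, smul_smul]
    norm_num
  have hxD : ∀ z, ψ.1 D z = ⁅ω D, z⁆ := fun z => by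
    have h := apply_lie_eq hC hH z
    rwa [hg.bCH, ← ωD] at h
  have hxC : ∀ z, ψ.1 C z = ⁅ω C, z⁆ := fun z => by
    have h := apply_lie_eq hD hC z
    rw [hg.bDC, map_smul, LinearMap.smul_apply] at h
    rw [ωC, smul_lie, ← h, smul_smul]
    norm_num
  have hDH : ω ⁅D, H⁆ = ψ.1 D H := by rw [hg.bDH, map_smul, ωH, smul_smul]; norm_num
  have hDC : ω ⁅D, C⁆ = ψ.1 D C := by rw [hg.bDC, map_smul, ωC, smul_smul]; norm_num
  have hCH : ω ⁅C, H⁆ = ψ.1 C H := by rw [hg.bCH, ωD]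
  have swap : ∀ {x z}, ω ⁅x, z⁆ = ψ.1 x z → ω ⁅z, x⁆ = ψ.1 z x := fun {x z} h => by
    rw [← lie_skew, map_neg, h, ψ.2.1 x z]
  have hdiag : ∀ x, ω ⁅x, x⁆ = ψ.1 x x := fun x => by rw [lie_self, map_zero, hself]
  have key : ∀ {x}, (∀ z, ψ.1 x z = ⁅ω x, z⁆) → ω ⁅x, H⁆ = ψ.1 x H → ω ⁅x, D⁆ = ψ.1 x D →
      ω ⁅x, C⁆ = ψ.1 x C → (∀ i ≤ N, ω ⁅x, P i 0⁆ = 0) → ψ.1 x = coboundary ω x := by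
    intro x hx h1 h2 h3 h4
    have hz : ∀ z, (∀ y, ψ.1 z y = ⁅ω z, y⁆) → ω ⁅x, z⁆ = ψ.1 x z →
        ψ.1 x z = coboundary ω x z := by
      intro z hz hω
      rw [coboundary_apply, hω, ← lie_skew, ← hz, ← lie_skew z, ← hx, ψ.2.1 x z]
      abel
    refine linearMap_ext_std hb (hz H hxH h1) (hz D hxD h2) (hz C hxC h3) ?_ fun i hi => ?_
    · rw [coboundary_apply, hx, ωM, hg.central, lie_mass hg, hg.central]
      simp
    · rw [coboundary_apply, hx, ωP, h4 i hi, ← lie_skew]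
      simp
  exact ⟨ω, key hxH (hdiag H) (swap hDH) (swap hCH)
      (fun i hi => by rw [hg.bHP i hi, map_smul, ωP, smul_zero]),
    key hxD hDH (hdiag D) hDC (fun i hi => by rw [hg.bDP i hi, map_smul, ωP, smul_zero]),
    key hxC hCH (swap hDC) (hdiag C) (fun i hi => by rw [hg.bCP i hi, map_smul, ωP, smul_zero])⟩

/-- On the momenta, a cocycle vanishing on `sl₂` is a multiple of the bracket. -/
theorem exists_apply_momentum_eq_smul_lie (hN : Odd N) (hg : IsCGAHat 1 N H D C M P Mc)
    (hb : ⇑b = stdFamily N H D C Mc P) {φ : cocycles g} (hH : φ.1 H = 0) (hD : φ.1 D = 0)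
    (hC : φ.1 C = 0) :
    ∃ μ : ℂ, ∀ i ≤ N, ∀ j ≤ N, φ.1 (P i 0) (P j 0) = μ • ⁅P i 0, P j 0⁆ := by
  have hskew : ∀ i j, φ.1 (P j 0) (P i 0) = -φ.1 (P i 0) (P j 0) := fun i j => φ.2.1 _ _
  have relD : ∀ i j, i ≤ N → j ≤ N → ⁅D, φ.1 (P i 0) (P j 0)⁆ =
      (2 * (((N : ℤ) - i - j : ℤ) : ℂ)) • φ.1 (P i 0) (P j 0) := fun i j hi hj => by
    rw [lie_apply_of_apply_eq_zero hD, hg.bDP i hi, hg.bDP j hj, map_smul, map_smul,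
      LinearMap.smul_apply, ← add_smul]
    congr 1
    push_cast
    ring
  have relC : ∀ i j, i ≤ N → j ≤ N → ⁅C, φ.1 (P i 0) (P j 0)⁆ =
      ((N : ℂ) - i) • φ.1 (P (i + 1) 0) (P j 0) + ((N : ℂ) - j) • φ.1 (P i 0) (P (j + 1) 0) :=
    fun i j hi hj => by
      rw [lie_apply_of_apply_eq_zero hC, hg.bCP i hi, hg.bCP j hj, map_smul, map_smul,
        LinearMap.smul_apply]
  have relH : ∀ i j, i ≤ N → j ≤ N → ⁅H, φ.1 (P i 0) (P j 0)⁆ =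
      (-(i : ℂ)) • φ.1 (P (i - 1) 0) (P j 0) + (-(j : ℂ)) • φ.1 (P i 0) (P (j - 1) 0) :=
    fun i j hi hj => by
      rw [lie_apply_of_apply_eq_zero hH, hg.bHP i hi, hg.bHP j hj, map_smul, map_smul,
        LinearMap.smul_apply]
  have hfar : ∀ i j, i ≤ N → j ≤ N → i + j + 1 ≠ N → i + j ≠ N → i + j ≠ N + 1 →
      φ.1 (P i 0) (P j 0) = 0 := fun i j hi hj h1 h2 h3 =>
    eq_zero_of_lie_eq_smul hN hg hb (relD i j hi hj) (by omega) (by omega) (by omega)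
  obtain ⟨m, hm⟩ := hN
  have hlow : ∀ i j, i + j + 1 = N → φ.1 (P i 0) (P j 0) = 0 := fun i j hij =>
    eq_zero_of_even_antidiagonal (N := N) (Y := fun i j => φ.1 (P i 0) (P j 0)) (r := m) hskew
      (fun i j hi hj h => by
        rw [← relC i j hi hj, hfar i j hi hj (by omega) (by omega) (by omega), lie_zero])
      (by omega) (by omega) (by omega)
  have hmass : ∀ i j, i + j = N → ∃ c : ℂ, φ.1 (P i 0) (P j 0) = c • Mc := by
    intro i j hij
    refine eq_smul_mass ⟨m, hm⟩ hg hb ?_ ?_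
    · rw [relD i j (by omega) (by omega), ← hij]
      simp
    · rw [relH i j (by omega) (by omega)]
      have h1 : (-(i : ℂ)) • φ.1 (P (i - 1) 0) (P j 0) = 0 := by
        rcases i with _ | i
        · simp
        · rw [hlow _ _ (by omega), smul_zero]
      have h2 : (-(j : ℂ)) • φ.1 (P i 0) (P (j - 1) 0) = 0 := by
        rcases j with _ | j
        · simp
        · rw [hlow _ _ (by omega), smul_zero]
      rw [h1, h2, add_zero]
  obtain ⟨c, hc⟩ := hmass 0 N (zero_add N)
  refine ⟨c / bcoef N 0, fun i hi j hj => ?_⟩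
  have hmid : ∀ i ≤ N, φ.1 (P i 0) (P (N - i) 0) =
      (c / bcoef N 0) • ⁅P i 0, P (N - i) 0⁆ := by
    intro i
    induction i with
    | zero =>
      intro _
      rw [Nat.sub_zero, hc, lie_momentum hg, if_pos (zero_add N), smul_smul,
        div_mul_cancel₀ _ (bcoef_ne_zero N 0)]
    | succ i ih =>
      intro hi
      have h1 := relC i (N - (i + 1)) (by omega) (by omega)
      have h2 : ⁅C, ⁅P i 0, P (N - (i + 1)) 0⁆⁆ = 0 := by
        rw [lie_momentum hg, if_neg (by omega), zero_smul, lie_zero]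
      rw [leibniz_lie, hg.bCP i (by omega), hg.bCP (N - (i + 1)) (by omega), smul_lie, lie_smul,
        show N - (i + 1) + 1 = N - i by omega] at h2
      rw [hlow _ _ (by omega), lie_zero, show N - (i + 1) + 1 = N - i by omega, ih (by omega),
        smul_comm _ (c / bcoef N 0), eq_neg_of_add_eq_zero_right h2, smul_neg,
        smul_comm (c / bcoef N 0), ← sub_eq_add_neg, ← smul_sub] at h1
      refine sub_eq_zero.1 ((smul_eq_zero.1 h1.symm).resolve_left ?_)
      rw [sub_eq_zero, Nat.cast_inj]
      omega
  by_cases hij : i + j = N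
  · obtain rfl : j = N - i := by omega
    exact hmid i hi
  · rw [lie_momentum hg, if_neg hij, zero_smul, smul_zero]
    by_cases h1 : i + j + 1 = N
    · exact hlow i j h1
    by_cases h3 : i + j = N + 1
    · refine eq_zero_of_even_antidiagonal (N := N) (Y := fun i j => φ.1 (P i 0) (P j 0))
        (r := m + 1) hskew (fun i j hi hj h => ?_) hi hj (by omega)
      obtain ⟨d, hd⟩ := hmass i j (by omega)
      rw [← relC i j hi hj, hd, lie_smul, hg.central, smul_zero]
    · exact hfar i j hi hj h1 hij h3

theorem apply_momentum_mass_eq_zero (hN : Odd N) (hg : IsCGAHat 1 N H D C M P Mc)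
    (hb : ⇑b = stdFamily N H D C Mc P) {φ : cocycles g} (hD : φ.1 D = 0)
    (hC : φ.1 C = 0) {i : ℕ} (hi : i ≤ N) : φ.1 (P i 0) Mc = 0 := by
  have hMc : Mc ≠ 0 := by
    have := b.ne_zero (.inl 3)
    rwa [hb] at this
  obtain ⟨c, hc⟩ : ∃ c : ℂ, φ.1 (P 0 0) Mc = c • P 0 0 := by
    refine eq_smul_momentum hN hg hb (Nat.zero_le N) ?_
    rw [lie_apply_of_apply_eq_zero hD, hg.bDP 0 (Nat.zero_le N), hg.central]
    simp
  have hall : ∀ i ≤ N, φ.1 (P i 0) Mc = c • P i 0 := by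
    intro i
    induction i with
    | zero => exact fun _ => hc
    | succ i ih =>
      intro hi
      have h := lie_apply_of_apply_eq_zero hC (P i 0) Mc
      rw [ih (by omega), lie_smul, hg.central, map_zero, add_zero, hg.bCP i (by omega), map_smul,
        LinearMap.smul_apply, smul_comm, ← sub_eq_zero, ← smul_sub] at h
      refine (sub_eq_zero.1 ((smul_eq_zero.1 h).resolve_left ?_)).symm
      rw [sub_eq_zero, Nat.cast_inj]
      omega
  have h := φ.2.2 (P 0 0) (P N 0) Mc
  have hMM : φ.1 Mc Mc = 0 := eq_zero_of_eq_neg (φ.2.1 Mc Mc)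
  rw [lie_mass hg, hg.central, hg.central, map_zero, LinearMap.zero_apply, hall 0 (Nat.zero_le N),
    hall N le_rfl, lie_smul, lie_smul, ← lie_skew (P 0 0) (P N 0), lie_momentum hg,
    if_pos (add_zero N)] at h
  have hc0 : c = 0 := by
    have h' : (2 * c * bcoef N N) • Mc = 0 := by
      rw [← neg_eq_zero, ← h]
      simp only [LinearMap.zero_apply, smul_zero, add_zero, sub_zero, smul_neg, map_neg, map_smul,
        LinearMap.neg_apply, LinearMap.smul_apply, hMM, neg_zero]
      module
    simpa [hMc, bcoef_ne_zero] using h'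
  rw [hall i hi, hc0, zero_smul]

theorem exists_eq_coboundary_of_apply_sl2_eq_zero (hN : Odd N) (hg : IsCGAHat 1 N H D C M P Mc)
    (hb : ⇑b = stdFamily N H D C Mc P) {φ : cocycles g} (hH : φ.1 H = 0) (hD : φ.1 D = 0)
    (hC : φ.1 C = 0) : ∃ ω : g →ₗ[ℂ] g, φ.1 = coboundary ω := by
  obtain ⟨μ, hμ⟩ := exists_apply_momentum_eq_smul_lie hN hg hb hH hD hC
  obtain ⟨ω, ωH, ωD, ωC, ωM, ωP⟩ := exists_linearMap_std hg hb 0 0 0 (-μ • Mc)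
  have hz : ∀ i ≤ N, φ.1 (P i 0) Mc = 0 := fun i hi => apply_momentum_mass_eq_zero hN hg hb hD hC hi
  have hsl : ∀ {x}, ω x = 0 → ω ⁅x, H⁆ = 0 → ω ⁅x, D⁆ = 0 → ω ⁅x, C⁆ = 0 →
      (∀ i ≤ N, ω ⁅x, P i 0⁆ = 0) → coboundary ω x = 0 := by
    intro x hx h1 h2 h3 h4
    refine linearMap_ext_std hb ?_ ?_ ?_ ?_ fun i hi => ?_
    · simp [coboundary_apply, hx, ωH, h1]
    · simp [coboundary_apply, hx, ωD, h2]
    · simp [coboundary_apply, hx, ωC, h3]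
    · simp [coboundary_apply, hx, ωM, hg.central]
    · simp [coboundary_apply, hx, ωP, h4 i hi]
  have bHC : ⁅H, C⁆ = -D := by rw [← lie_skew, hg.bCH]
  have bHD : ⁅H, D⁆ = -((2 : ℂ) • H) := by rw [← lie_skew, hg.bDH]
  have bCD : ⁅C, D⁆ = -((-2 : ℂ) • C) := by rw [← lie_skew, hg.bDC]
  have ωH' : coboundary ω H = 0 := hsl ωH (by simp) (by simp [bHD, ωH]) (by simp [bHC, ωD])
    fun i hi => by simp [hg.bHP i hi, ωP]
  have ωD' : coboundary ω D = 0 := hsl ωD (by simp [hg.bDH, ωH]) (by simp) (by simp [hg.bDC, ωC])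
    fun i hi => by simp [hg.bDP i hi, ωP]
  have ωC' : coboundary ω C = 0 := hsl ωC (by simp [hg.bCH, ωD]) (by simp [bCD, ωC]) (by simp)
    fun i hi => by simp [hg.bCP i hi, ωP]
  have hcob := (coboundary_mem_cocycles ω).1
  have hright : ∀ {x} (y : g), φ.1 x = 0 → coboundary ω x = 0 →
      φ.1 y x = coboundary ω y x := fun {x} y h h' => by
    rw [φ.2.1 x y, hcob x y, h, h']
  refine ⟨ω, linearMap_ext_std hb (hH.trans ωH'.symm) (hD.trans ωD'.symm) (hC.trans ωC'.symm) ?_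
    fun i hi => ?_⟩
  · refine linearMap_ext_std hb (hright _ hH ωH') (hright _ hD ωD') (hright _ hC ωC') ?_
      fun i hi => ?_
    · rw [eq_zero_of_eq_neg (φ.2.1 Mc Mc), eq_zero_of_eq_neg (hcob Mc Mc)]
    · rw [φ.2.1 (P i 0) Mc, hz i hi, coboundary_apply, ωM, ωP]
      simp [hg.central, lie_mass hg]
  · refine linearMap_ext_std hb (hright _ hH ωH') (hright _ hD ωD') (hright _ hC ωC') ?_
      fun j hj => ?_
    · rw [hz i hi, coboundary_apply, ωM, ωP]
      simp [hg.central, lie_mass hg]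
    · rw [hμ i hi j hj, coboundary_apply, ωP, ωP, lie_momentum hg, map_smul, ωM]
      simp only [lie_zero, neg_smul, smul_neg, sub_zero, sub_neg_eq_add, zero_add]
      exact smul_comm _ _ _

end Basis

theorem exists_eq_coboundary (hN : Odd N) (hg : IsCGAHat 1 N H D C M P Mc) (φ : cocycles g) :
    ∃ ω : g →ₗ[ℂ] g, φ.1 = coboundary ω := by
  have := finiteDimensional hg
  obtain ⟨b, hb⟩ := exists_basis hg
  obtain ⟨ω₁, ψ, hφ, hH, hD, hC⟩ := exists_coboundary_add_invariant hg.bDH hg.bCH hg.bDC φ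
  obtain ⟨ω₂, h₁, h₂, h₃⟩ := exists_coboundary_eq_on_sl2 hg hb hH hD hC
  obtain ⟨ω₃, h⟩ := exists_eq_coboundary_of_apply_sl2_eq_zero hN hg hb
    (φ := ⟨ψ.1 - coboundary ω₂, (cocycles g).sub_mem ψ.2 (coboundary_mem_cocycles ω₂)⟩)
    (sub_eq_zero.2 h₁) (sub_eq_zero.2 h₂) (sub_eq_zero.2 h₃)
  refine ⟨ω₁ + (ω₃ + ω₂), ?_⟩
  rw [hφ, map_add, map_add, ← h, sub_add_cancel]

end ConformalGalilei

/-- Every adjoint `2`-cocycle is given by an element of `cocycles g`. -/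
theorem exists_cocycles_eq {g : Type*} [LieRing g] [LieAlgebra ℂ g] {φ : g → g → g}
    (hφ : IsAdCocycle2 φ) : ∃ ψ : cocycles g, ∀ a b, ψ.1 a b = φ a b :=
  ⟨⟨LinearMap.mk₂ ℂ φ hφ.addl hφ.smull
    (fun a b c => by rw [hφ.skew, hφ.addl, neg_add, ← hφ.skew, ← hφ.skew])
    (fun t a b => by rw [hφ.skew, hφ.smull, ← smul_neg, ← hφ.skew]),
    hφ.skew, hφ.cocycle⟩, fun _ _ => rfl⟩

end AdjointCohomology

/-- For `g = ĉga_ℓ(1,ℂ) = sl(2,ℂ) ⋉ h` with `h` the `(2ℓ+2)`-dimensional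
Heisenberg algebra and `ℓ ∈ 1/2 + ℕ₀` (`N = 2ℓ` odd): `H²(g,g) = 0`. -/
theorem stmt17 (N : ℕ) (hN : Odd N)
    {g : Type*} [LieRing g] [LieAlgebra ℂ g]
    (H D C : g) (M : Fin 1 → Fin 1 → g) (P : ℕ → Fin 1 → g) (Mc : g)
    (hg : IsCGAHat 1 N H D C M P Mc) :
    H2IsTrivial g := by
  intro φ hφ
  obtain ⟨ψ, hψ⟩ := AdjointCohomology.exists_cocycles_eq hφ
  obtain ⟨ω, hω⟩ := AdjointCohomology.exists_eq_coboundary hN hg ψ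
  exact ⟨ω, fun a b => by rw [← hψ, hω]; rfl⟩
end
end

section
/- Let g = ĉga_ℓ(2,ℂ) with ℓ ∈ 1/2 + ℕ₀, ℓ ≥ 3/2. Then H²(g,g) ≅ ℂ. -/
noncomputable section

open Module

section Cochains

variable {g : Type*} [LieRing g] [LieAlgebra ℂ g]

namespace IsAdCocycle2

variable {φ : g → g → g} (hφ : IsAdCocycle2 φ)

include hφ

theorem addr (a b c : g) : φ a (b + c) = φ a b + φ a c := by
  rw [hφ.skew (b + c) a, hφ.addl, hφ.skew a b, hφ.skew a c]
  abel

theorem smulr (t : ℂ) (a b : g) : φ a (t • b) = t • φ a b := by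
  rw [hφ.skew (t • b) a, hφ.smull, ← smul_neg, ← hφ.skew b a]

theorem zerol (a : g) : φ 0 a = 0 := by
  simpa using hφ.smull 0 0 a

theorem zeror (a : g) : φ a 0 = 0 := by
  simpa using hφ.smulr 0 a 0

theorem negl (a b : g) : φ (-a) b = -φ a b := by
  simpa using hφ.smull (-1) a b

theorem self (a : g) : φ a a = 0 :=
  have := IsAddTorsionFree.of_isTorsionFree ℂ g
  self_eq_neg.mp (hφ.skew a a)

theorem skew_zero {a b : g} (h : φ a b = 0) : φ b a = 0 := by
  rw [hφ.skew a b, h, neg_zero]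

end IsAdCocycle2

/-- A cocycle bundled as a bilinear map. -/
def IsAdCocycle2.bilin {φ : g → g → g} (hφ : IsAdCocycle2 φ) : g →ₗ[ℂ] g →ₗ[ℂ] g :=
  LinearMap.mk₂ ℂ φ hφ.addl hφ.smull hφ.addr hφ.smulr

theorem IsAdCocycle2.sub {φ χ : g → g → g} (hφ : IsAdCocycle2 φ) (hχ : IsAdCocycle2 χ) :
    IsAdCocycle2 (fun a b => φ a b - χ a b) where
  addl a b c := by rw [hφ.addl, hχ.addl]; abel
  smull t a b := by rw [hφ.smull, hχ.smull, smul_sub]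
  skew a b := by rw [hφ.skew a b, hχ.skew a b]; abel
  cocycle a b c := by
    have h₁ := hφ.cocycle a b c
    have h₂ := hχ.cocycle a b c
    simp only [lie_sub]
    linear_combination (norm := module) h₁ - h₂

theorem IsAdCocycle2.smul {φ : g → g → g} (hφ : IsAdCocycle2 φ) (t : ℂ) :
    IsAdCocycle2 (fun a b => t • φ a b) where
  addl a b c := by rw [hφ.addl, smul_add]
  smull s a b := by rw [hφ.smull, smul_comm]
  skew a b := by rw [hφ.skew a b, smul_neg]
  cocycle a b c := by
    have h₁ := hφ.cocycle a b c
    simp only [lie_smul]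
    linear_combination (norm := module) t • h₁

theorem isAdCocycle2_cob (ω : g →ₗ[ℂ] g) : IsAdCocycle2 (cob ω) where
  addl a b c := by simp only [cob, map_add, add_lie, lie_add]; abel
  smull t a b := by simp only [cob, map_smul, smul_lie, lie_smul, smul_sub]
  skew a b := by
    have h : ω ⁅b, a⁆ = -ω ⁅a, b⁆ := by rw [← lie_skew, map_neg]
    simp only [cob, h]; abel
  cocycle a b c := by
    have h : ω ⁅a, ⁅b, c⁆⁆ = ω ⁅⁅a, b⁆, c⁆ + ω ⁅b, ⁅a, c⁆⁆ := by
      rw [← map_add, ← leibniz_lie]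
    have h₁ : ω ⁅⁅b, c⁆, a⁆ = - ω ⁅a, ⁅b, c⁆⁆ := by rw [← lie_skew, map_neg]
    have h₂ : ω ⁅⁅a, c⁆, b⁆ = - ω ⁅b, ⁅a, c⁆⁆ := by rw [← lie_skew, map_neg]
    have j₁ := lie_lie a b (ω c)
    have j₂ := lie_lie a c (ω b)
    have j₃ := lie_lie b c (ω a)
    simp only [cob, lie_sub, h₁, h₂, h]
    linear_combination (norm := module) j₂ - j₁ - j₃

/-- A bilinear cochain is `T`-invariant if `ad T` acts on it as zero. -/
def IsAdInvariant (T : g) (φ : g → g → g) : Prop :=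
  ∀ a b, ⁅T, φ a b⁆ = φ ⁅T, a⁆ b + φ a ⁅T, b⁆

omit [LieAlgebra ℂ g] in
theorem IsAdInvariant.sub {T : g} {φ χ : g → g → g} (hφ : IsAdInvariant T φ)
    (hχ : IsAdInvariant T χ) : IsAdInvariant T (fun a b => φ a b - χ a b) := by
  intro a b
  rw [lie_sub, hφ, hχ]
  module

theorem IsAdInvariant.smul {T : g} {φ : g → g → g} (hφ : IsAdInvariant T φ) (t : ℂ) :
    IsAdInvariant T (fun a b => t • φ a b) := by
  intro a b
  rw [lie_smul, hφ, smul_add]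

theorem lie_cob (T : g) (ω : g →ₗ[ℂ] g) (a b : g) :
    ⁅T, cob ω a b⁆ = cob ω ⁅T, a⁆ b + cob ω a ⁅T, b⁆
      + (⁅a, ⁅T, ω b⁆ - ω ⁅T, b⁆⁆ - ⁅b, ⁅T, ω a⁆ - ω ⁅T, a⁆⁆
        - (⁅T, ω ⁅a, b⁆⁆ - ω ⁅T, ⁅a, b⁆⁆)) := by
  simp only [cob, lie_sub, leibniz_lie T a b, map_add]
  have j₁ := leibniz_lie T a (ω b)
  have j₂ := leibniz_lie T b (ω a)
  linear_combination (norm := module) j₁ - j₂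

theorem isAdInvariant_cob {T : g} {ω : g →ₗ[ℂ] g} (hω : ∀ x, ω ⁅T, x⁆ = ⁅T, ω x⁆) :
    IsAdInvariant T (cob ω) := by
  intro a b
  rw [lie_cob]
  simp [hω]

variable {ι : Type*} [Fintype ι] (e : Basis ι ℂ g)

omit [Fintype ι] in
theorem repr_lie_of_eigenbasis {T : g} {μ : ι → ℂ} (hT : ∀ i, ⁅T, e i⁆ = μ i • e i)
    (v : g) (k : ι) :
    e.repr ⁅T, v⁆ k = μ k * e.repr v k := by
  classical
  have h : (e.coord k) ∘ₗ (LieAlgebra.ad ℂ g T : g →ₗ[ℂ] g) = μ k • e.coord k := by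
    refine e.ext fun i => ?_
    by_cases hik : i = k
    · subst hik; simp [hT]
    · simp [hT, hik]
  simpa using LinearMap.congr_fun h v

/-- Every cocycle is cohomologous to one which is invariant under a given
diagonalizable element. -/
theorem IsAdCocycle2.exists_isAdInvariant {T : g} {μ : ι → ℂ}
    (hT : ∀ i, ⁅T, e i⁆ = μ i • e i) {φ : g → g → g} (hφ : IsAdCocycle2 φ) :
    ∃ ω : g →ₗ[ℂ] g, IsAdInvariant T (fun a b => φ a b - cob ω a b) := by
  classical
  let f : g →ₗ[ℂ] g := hφ.bilin T
  have hf : ∀ x, f x = φ T x := fun x => rfl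
  let f₀ : g →ₗ[ℂ] g :=
    e.constr ℂ fun j => ∑ i, (if μ i = μ j then e.repr (f (e j)) i else 0) • e i
  let ω : g →ₗ[ℂ] g :=
    e.constr ℂ fun j => ∑ i, (e.repr (f (e j)) i / (μ i - μ j)) • e i
  have hf₀ : ∀ x, f₀ ⁅T, x⁆ = ⁅T, f₀ x⁆ := by
    have : f₀ ∘ₗ (LieAlgebra.ad ℂ g T : g →ₗ[ℂ] g)
        = (LieAlgebra.ad ℂ g T : g →ₗ[ℂ] g) ∘ₗ f₀ := by
      refine e.ext fun j => ?_
      simp only [LinearMap.comp_apply, LieAlgebra.ad_apply, hT, map_smul,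
        f₀, Basis.constr_basis, lie_sum, lie_smul, Finset.smul_sum, smul_smul]
      refine Finset.sum_congr rfl fun i _ => ?_
      by_cases h : μ i = μ j
      · simp [h, mul_comm]
      · simp [h]
    exact fun x => LinearMap.congr_fun this x
  have hω : ∀ x, ⁅T, ω x⁆ - ω ⁅T, x⁆ = f x - f₀ x := by
    have : (LieAlgebra.ad ℂ g T : g →ₗ[ℂ] g) ∘ₗ ω - ω ∘ₗ (LieAlgebra.ad ℂ g T : g →ₗ[ℂ] g)
        = f - f₀ := by
      refine e.ext fun j => ?_
      have hfj : f (e j) = ∑ i, e.repr (f (e j)) i • e i := (e.sum_repr _).symm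
      simp only [LinearMap.sub_apply, LinearMap.comp_apply]
      rw [hfj]
      simp only [LieAlgebra.ad_apply, hT, map_smul,
        f₀, ω, Basis.constr_basis, lie_sum, lie_smul, Finset.smul_sum, smul_smul,
        ← Finset.sum_sub_distrib, ← sub_smul]
      refine Finset.sum_congr rfl fun i _ => ?_
      congr 1
      by_cases h : μ i = μ j
      · simp [h]
      · have : μ i - μ j ≠ 0 := sub_ne_zero.mpr h
        simp only [h, if_false]
        field_simp
        simp
    exact fun x => LinearMap.congr_fun this x
  refine ⟨ω, ?_⟩
  set χ : g → g → g := fun a b => φ a b - cob ω a b with hχdef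
  have hχ : IsAdCocycle2 χ := hφ.sub (isAdCocycle2_cob ω)
  have key : ∀ a b, ⁅T, χ a b⁆ = χ ⁅T, a⁆ b + χ a ⁅T, b⁆ + cob f₀ a b := by
    intro a b
    have h₁ := hφ.cocycle T a b
    have h₂ := hφ.skew ⁅T, b⁆ a
    have h₃ := hφ.skew T ⁅a, b⁆
    have h₄ := lie_cob T ω a b
    simp only [hω, hf, lie_sub] at h₄
    simp only [hχdef, lie_sub, cob] at h₄ ⊢
    linear_combination (norm := module) h₁ - h₄ - h₂ + h₃
  have hzero : ∀ i j, cob f₀ (e i) (e j) = 0 := by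
    intro i j
    have h₁ := key (e i) (e j)
    have h₂ := isAdInvariant_cob hf₀ (e i) (e j)
    simp only [hT, hχ.smull, hχ.smulr, (isAdCocycle2_cob f₀).smull,
      (isAdCocycle2_cob f₀).smulr] at h₁ h₂
    apply e.repr.injective
    ext k
    have k₁ := congrArg (fun v => e.repr v k) h₁
    have k₂ := congrArg (fun v => e.repr v k) h₂
    simp only [repr_lie_of_eigenbasis e hT, map_add, map_smul, Finsupp.add_apply,
      Finsupp.smul_apply, smul_eq_mul] at k₁ k₂
    rw [map_zero, Finsupp.zero_apply]
    have k₃ : (e.repr (cob f₀ (e i) (e j)) k) ^ 2 = 0 := by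
      linear_combination (-e.repr (cob f₀ (e i) (e j)) k) * k₁ + e.repr (χ (e i) (e j)) k * k₂
    exact pow_eq_zero_iff two_ne_zero |>.mp k₃
  have hzero_right : ∀ a b, cob f₀ a b = 0 := by
    have : (isAdCocycle2_cob f₀).bilin = 0 :=
      LinearMap.ext_basis e e fun i j => hzero i j
    exact fun a b => LinearMap.congr_fun₂ this a b
  intro a b
  rw [key, hzero_right, add_zero]

/-- A derivation and a linear form vanishing on brackets give a cocycle. -/
theorem isAdCocycle2_wedge {r : g →ₗ[ℂ] ℂ} {E : g →ₗ[ℂ] g} (hr : ∀ a b : g, r ⁅a, b⁆ = 0)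
    (hE : ∀ a b : g, E ⁅a, b⁆ = ⁅a, E b⁆ + ⁅E a, b⁆) :
    IsAdCocycle2 (fun a b => r a • E b - r b • E a) where
  addl a b c := by simp only [map_add]; module
  smull t a b := by simp only [map_smul, smul_eq_mul]; module
  skew a b := by abel
  cocycle a b c := by
    have s₁ := lie_skew b (E a)
    have s₂ := lie_skew c (E a)
    have s₃ := lie_skew c (E b)
    simp only [hr, hE, lie_sub, lie_smul, ← s₁, ← s₂, ← s₃]
    module

end Cochains

section ChiralBasis

/-- The eigenvalues `±i` of the rotation generator on the chiral vectors. -/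
def chirality : Bool → ℂ
  | true => Complex.I
  | false => -Complex.I

theorem chirality_im (s : Bool) : (chirality s).im = if s then 1 else -1 := by
  cases s <;> simp [chirality]

theorem chirality_re (s : Bool) : (chirality s).re = 0 := by
  cases s <;> simp [chirality]

theorem chirality_ne_zero (s : Bool) : chirality s ≠ 0 := by
  cases s <;> simp [chirality]

/-- A basis of `ĉga_ℓ(2,ℂ)`, `N = 2ℓ`, on which both the dilation `D` and the rotation `R`
are diagonal: `P s n` are the chiral combinations of the vectors `P_{n,1}`, `P_{n,2}`. -/
structure IsChiralBasis {g : Type*} [LieRing g] [LieAlgebra ℂ g] (N : ℕ)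
    (e : Basis (Fin 5 ⊕ Bool × Fin (N + 1)) ℂ g)
    (H D C R Z : g) (P : Bool → ℕ → g) (β : ℕ → ℂ) : Prop where
  e_inl : ∀ i, e (Sum.inl i) = ![H, D, C, R, Z] i
  e_inr : ∀ p, e (Sum.inr p) = P p.1 p.2
  P_eq_zero : ∀ s n, N < n → P s n = 0
  DH : ⁅D, H⁆ = (2 : ℂ) • H
  CH : ⁅C, H⁆ = D
  DC : ⁅D, C⁆ = (-2 : ℂ) • C
  RH : ⁅R, H⁆ = 0
  RD : ⁅R, D⁆ = 0
  RC : ⁅R, C⁆ = 0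
  lie_Z : ∀ x : g, ⁅x, Z⁆ = 0
  HP_zero : ∀ s, ⁅H, P s 0⁆ = 0
  HP : ∀ s, ∀ n < N, ⁅H, P s (n + 1)⁆ = (-(n + 1 : ℂ)) • P s n
  DP : ∀ s n, ⁅D, P s n⁆ = ((N : ℂ) - 2 * n) • P s n
  CP : ∀ s n, ⁅C, P s n⁆ = ((N : ℂ) - n) • P s (n + 1)
  RP : ∀ s n, ⁅R, P s n⁆ = chirality s • P s n
  PP : ∀ s t m n, ⁅P s m, P t n⁆ = (if s ≠ t ∧ m + n = N then β m else 0) • Z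
  β_zero : β 0 ≠ 0
  β_last : β N ≠ 0

/-- The weights of a chiral basis under `D + R`. -/
def chiralWeight (N : ℕ) : Fin 5 ⊕ Bool × Fin (N + 1) → ℂ :=
  Sum.elim ![2, 0, -2, 0, 0] fun p => ((N : ℂ) - 2 * (p.2 : ℕ)) + chirality p.1

namespace IsChiralBasis

variable {g : Type*} [LieRing g] [LieAlgebra ℂ g] {N : ℕ}
  {e : Basis (Fin 5 ⊕ Bool × Fin (N + 1)) ℂ g}
  {H D C R Z : g} {P : Bool → ℕ → g} {β : ℕ → ℂ}

variable (hb : IsChiralBasis N e H D C R Z P β)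

include hb

theorem HD : ⁅H, D⁆ = (-2 : ℂ) • H := by rw [← lie_skew, hb.DH]; module
theorem HC : ⁅H, C⁆ = -D := by rw [← lie_skew, hb.CH]
theorem HR : ⁅H, R⁆ = 0 := by rw [← lie_skew, hb.RH, neg_zero]
theorem DR : ⁅D, R⁆ = 0 := by rw [← lie_skew, hb.RD, neg_zero]
theorem CR : ⁅C, R⁆ = 0 := by rw [← lie_skew, hb.RC, neg_zero]
theorem Z_lie (x : g) : ⁅Z, x⁆ = 0 := by rw [← lie_skew, hb.lie_Z, neg_zero]
theorem PD (s : Bool) (n : ℕ) : ⁅P s n, D⁆ = (-((N : ℂ) - 2 * n)) • P s n := by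
  rw [← lie_skew, hb.DP, neg_smul]
theorem PR (s : Bool) (n : ℕ) : ⁅P s n, R⁆ = (-chirality s) • P s n := by
  rw [← lie_skew, hb.RP, neg_smul]
theorem PP_same (s : Bool) (m n : ℕ) : ⁅P s m, P s n⁆ = 0 := by simp [hb.PP]

theorem e_P (s : Bool) {n : ℕ} (hn : n ≤ N) :
    e (Sum.inr (s, ⟨n, Nat.lt_succ_of_le hn⟩)) = P s n := hb.e_inr _

theorem e_H : e (Sum.inl 0) = H := hb.e_inl 0
theorem e_D : e (Sum.inl 1) = D := hb.e_inl 1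
theorem e_C : e (Sum.inl 2) = C := hb.e_inl 2
theorem e_R : e (Sum.inl 3) = R := hb.e_inl 3
theorem e_Z : e (Sum.inl 4) = Z := hb.e_inl 4

theorem D_ne_zero : D ≠ 0 := hb.e_D ▸ e.ne_zero _
theorem P_ne_zero (s : Bool) {n : ℕ} (hn : n ≤ N) : P s n ≠ 0 := hb.e_P s hn ▸ e.ne_zero _

/-- To prove something for all basis vectors, treat the generators one by one. -/
theorem basis_cases {p : g → Prop} (pH : p H) (pD : p D) (pC : p C) (pR : p R) (pZ : p Z)
    (pP : ∀ s, ∀ n ≤ N, p (P s n)) (i : Fin 5 ⊕ Bool × Fin (N + 1)) : p (e i) := by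
  rcases i with i | ⟨s, n⟩
  · rw [hb.e_inl]
    fin_cases i <;> assumption
  · rw [hb.e_inr]
    exact pP s n (Nat.le_of_lt_succ n.2)

theorem ext_map {W : Type*} [AddCommGroup W] [Module ℂ W] {f : g →ₗ[ℂ] W} (fH : f H = 0)
    (fD : f D = 0) (fC : f C = 0) (fR : f R = 0) (fZ : f Z = 0)
    (fP : ∀ s, ∀ n ≤ N, f (P s n) = 0) (x : g) : f x = 0 := by
  have : f = 0 := e.ext (hb.basis_cases (p := fun x => f x = 0) fH fD fC fR fZ fP)
  rw [this, LinearMap.zero_apply]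

theorem ext_skew {W : Type*} [AddCommGroup W] [Module ℂ W] (φ : g →ₗ[ℂ] g →ₗ[ℂ] W)
    (hφ : ∀ a b, φ b a = -φ a b)
    (hHD : φ H D = 0) (hHC : φ H C = 0) (hHR : φ H R = 0) (hHZ : φ H Z = 0)
    (hHP : ∀ s, ∀ n ≤ N, φ H (P s n) = 0)
    (hDC : φ D C = 0) (hDR : φ D R = 0) (hDZ : φ D Z = 0) (hDP : ∀ s, ∀ n ≤ N, φ D (P s n) = 0)
    (hCR : φ C R = 0) (hCZ : φ C Z = 0) (hCP : ∀ s, ∀ n ≤ N, φ C (P s n) = 0)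
    (hRZ : φ R Z = 0) (hRP : ∀ s, ∀ n ≤ N, φ R (P s n) = 0)
    (hZP : ∀ s, ∀ n ≤ N, φ Z (P s n) = 0)
    (hPP : ∀ s t m n, φ (P s m) (P t n) = 0) (a b : g) : φ a b = 0 := by
  have skew : ∀ {a b}, φ a b = 0 → φ b a = 0 := fun {a b} h => by rw [hφ a b, h, neg_zero]
  have self : ∀ a, φ a a = 0 := fun a => by
    have := IsAddTorsionFree.of_isTorsionFree ℂ W
    exact self_eq_neg.mp (hφ a a)
  have hH := hb.ext_map (self H) hHD hHC hHR hHZ hHP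
  have hD := hb.ext_map (skew hHD) (self D) hDC hDR hDZ hDP
  have hC := hb.ext_map (skew hHC) (skew hDC) (self C) hCR hCZ hCP
  have hR := hb.ext_map (skew hHR) (skew hDR) (skew hCR) (self R) hRZ hRP
  have hZ := hb.ext_map (skew hHZ) (skew hDZ) (skew hCZ) (skew hRZ) (self Z) hZP
  exact hb.ext_map (f := φ.flip b) (hH b) (hD b) (hC b) (hR b) (hZ b)
    (fun s n hn => hb.ext_map (f := φ (P s n)) (skew (hHP s n hn)) (skew (hDP s n hn))
      (skew (hCP s n hn)) (skew (hRP s n hn)) (skew (hZP s n hn)) (fun t m _ => hPP s t n m) b) a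

theorem lie_basis (i : Fin 5 ⊕ Bool × Fin (N + 1)) :
    ⁅D + R, e i⁆ = chiralWeight N i • e i := by
  rcases i with i | ⟨s, n⟩
  · rw [hb.e_inl]
    fin_cases i <;>
      simp [chiralWeight, hb.DH, hb.RH, hb.RD, hb.DR, hb.DC, hb.RC, hb.lie_Z]
  · rw [hb.e_inr]
    simp [chiralWeight, hb.DP, hb.RP, add_smul]

theorem repr_eq_zero {v : g} {μ : ℂ} (hv : ⁅D + R, v⁆ = μ • v)
    {k : Fin 5 ⊕ Bool × Fin (N + 1)} (hk : chiralWeight N k ≠ μ) : e.repr v k = 0 := by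
  have h := repr_lie_of_eigenbasis e hb.lie_basis v k
  rw [hv, map_smul, Finsupp.smul_apply, smul_eq_mul] at h
  have h' : (chiralWeight N k - μ) * e.repr v k = 0 := by linear_combination -h
  exact (mul_eq_zero.mp h').resolve_left (sub_ne_zero.mpr hk)

theorem expand (v : g) : v = e.repr v (Sum.inl 0) • H + e.repr v (Sum.inl 1) • D
    + e.repr v (Sum.inl 2) • C + e.repr v (Sum.inl 3) • R + e.repr v (Sum.inl 4) • Z
    + ∑ p : Bool × Fin (N + 1), e.repr v (Sum.inr p) • P p.1 p.2 := by
  conv_lhs => rw [← e.sum_repr v]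
  simp only [Fintype.sum_sum_type, Fin.sum_univ_five, hb.e_H, hb.e_D, hb.e_C, hb.e_R, hb.e_Z,
    hb.e_inr]

theorem eq_zero_of_weight {v : g} {μ : ℂ} (hv : ⁅D + R, v⁆ = μ • v)
    (hμ : ∀ k, chiralWeight N k ≠ μ) : v = 0 :=
  e.repr.injective <| Finsupp.ext fun k => by simpa using hb.repr_eq_zero hv (hμ k)

theorem eq_smul_of_weight {v : g} {μ : ℂ} (hv : ⁅D + R, v⁆ = μ • v)
    (k : Fin 5 ⊕ Bool × Fin (N + 1)) (hμ : ∀ j, chiralWeight N j = μ → j = k) :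
    ∃ x : ℂ, v = x • e k := by
  refine ⟨e.repr v k, ?_⟩
  conv_lhs => rw [← e.sum_repr v]
  refine Finset.sum_eq_single k (fun j _ hj => ?_) (by simp)
  rw [hb.repr_eq_zero hv fun h => hj (hμ j h), zero_smul]

omit hb in
theorem chiralWeight_inr_im (p : Bool × Fin (N + 1)) :
    (chiralWeight N (Sum.inr p)).im = if p.1 then 1 else -1 := by
  simp [chiralWeight, chirality_im]

omit hb in
theorem chiralWeight_inl_im (i : Fin 5) : (chiralWeight N (Sum.inl i)).im = 0 := by
  fin_cases i <;> simp [chiralWeight]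

omit hb in
theorem chiralWeight_inr_re (p : Bool × Fin (N + 1)) :
    (chiralWeight N (Sum.inr p)).re = (N : ℝ) - 2 * (p.2 : ℕ) := by
  simp [chiralWeight, chirality_re]

omit hb in
theorem chiralWeight_inr_ne {μ : ℂ} (hμ : μ.im = 0) (p : Bool × Fin (N + 1)) :
    chiralWeight N (Sum.inr p) ≠ μ := by
  intro h
  have := congrArg Complex.im h
  rw [chiralWeight_inr_im, hμ] at this
  split_ifs at this <;> norm_num at this

omit hb in
theorem chiralWeight_inl_ne {μ : ℂ} (hμ : μ.im ≠ 0) (i : Fin 5) :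
    chiralWeight N (Sum.inl i) ≠ μ := by
  rintro rfl
  exact hμ (chiralWeight_inl_im i)

theorem exists_of_weight_zero {v : g} (hv : ⁅D + R, v⁆ = (0 : ℂ) • v) :
    ∃ x y z : ℂ, v = x • D + y • R + z • Z := by
  refine ⟨e.repr v (Sum.inl 1), e.repr v (Sum.inl 3), e.repr v (Sum.inl 4), ?_⟩
  conv_lhs => rw [hb.expand v]
  rw [hb.repr_eq_zero hv (k := Sum.inl 0) (by simp [chiralWeight]),
    hb.repr_eq_zero hv (k := Sum.inl 2) (by simp [chiralWeight]),
    Finset.sum_eq_zero fun p _ => by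
      rw [hb.repr_eq_zero hv (chiralWeight_inr_ne (by simp) p), zero_smul]]
  module

theorem exists_of_weight_two {v : g} (hv : ⁅D + R, v⁆ = (2 : ℂ) • v) : ∃ x : ℂ, v = x • H := by
  rw [← hb.e_H]
  refine hb.eq_smul_of_weight hv _ ?_
  rintro (i | p) hj
  · fin_cases i <;> first | rfl | (norm_num [chiralWeight] at hj)
  · exact absurd hj (chiralWeight_inr_ne (by simp) p)

theorem exists_of_weight_neg_two {v : g} (hv : ⁅D + R, v⁆ = (-2 : ℂ) • v) :
    ∃ x : ℂ, v = x • C := by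
  rw [← hb.e_C]
  refine hb.eq_smul_of_weight hv _ ?_
  rintro (i | p) hj
  · fin_cases i <;> first | rfl | (norm_num [chiralWeight] at hj)
  · exact absurd hj (chiralWeight_inr_ne (by simp) p)

omit hb in
theorem re_eq_and_eq_of_chiralWeight_eq {p : Bool × Fin (N + 1)} {m : ℤ} {s : Bool}
    (h : chiralWeight N (Sum.inr p) = m + chirality s) :
    (N : ℤ) - 2 * (p.2 : ℕ) = m ∧ p.1 = s := by
  have h₁ := congrArg Complex.re h
  have h₂ := congrArg Complex.im h
  rw [chiralWeight_inr_re] at h₁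
  rw [chiralWeight_inr_im] at h₂
  simp only [Complex.add_re, Complex.add_im, Complex.intCast_re, Complex.intCast_im,
    chirality_re, chirality_im, add_zero, zero_add] at h₁ h₂
  refine ⟨by exact_mod_cast h₁, ?_⟩
  cases s <;> cases hp : p.1 <;> simp [hp] at h₂ ⊢ <;> norm_num at h₂

omit hb in
theorem intCast_add_chirality_im_ne_zero (m : ℤ) (s : Bool) :
    ((m : ℂ) + chirality s).im ≠ 0 := by
  cases s <;> simp [chirality]

theorem exists_of_weight_P {v : g} {s : Bool} {n : ℕ} (hn : n ≤ N)
    (hv : ⁅D + R, v⁆ = ((N : ℂ) - 2 * n + chirality s) • v) : ∃ x : ℂ, v = x • P s n := by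
  rw [← hb.e_P s hn]
  have hμ : (N : ℂ) - 2 * n + chirality s = (((N : ℤ) - 2 * n : ℤ) : ℂ) + chirality s := by
    push_cast; ring
  rw [hμ] at hv
  refine hb.eq_smul_of_weight hv _ ?_
  rintro (i | ⟨t, m⟩) hj
  · exact absurd hj (chiralWeight_inl_ne (intCast_add_chirality_im_ne_zero _ _) i)
  · obtain ⟨h₁, h₂⟩ := re_eq_and_eq_of_chiralWeight_eq hj
    simp only at h₁ h₂
    congr 2
    ext
    simp only
    omega

theorem eq_zero_of_weight_P {v : g} {s : Bool} {m : ℤ}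
    (hv : ⁅D + R, v⁆ = ((m : ℂ) + chirality s) • v) (hm : m < -N ∨ N < m) : v = 0 := by
  refine hb.eq_zero_of_weight hv ?_
  rintro (i | ⟨t, n⟩) hj
  · exact absurd hj (chiralWeight_inl_ne (intCast_add_chirality_im_ne_zero _ _) i)
  · obtain ⟨h₁, h₂⟩ := re_eq_and_eq_of_chiralWeight_eq hj
    have := n.2
    simp only at h₁
    omega

theorem eq_zero_of_large_weight {v : g} {m : ℤ} (hv : ⁅D + R, v⁆ = (m : ℂ) • v)
    (hm : m < -2 ∨ 2 < m) : v = 0 := by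
  refine hb.eq_zero_of_weight hv ?_
  rintro (i | p) hj
  · have h : chiralWeight N (Sum.inl i) = ((![2, 0, -2, 0, 0] i : ℤ) : ℂ) := by
      fin_cases i <;> simp [chiralWeight]
    rw [h, Int.cast_inj] at hj
    subst hj
    fin_cases i <;> simp at hm
  · exact absurd hj (chiralWeight_inr_ne (by simp) p)

theorem eq_zero_of_weight_two_chirality {v : g} {m : ℂ} {s : Bool} (hm : m.im = 0)
    (hv : ⁅D + R, v⁆ = (m + 2 * chirality s) • v) : v = 0 := by
  have him : (m + 2 * chirality s).im = if s then 2 else -2 := by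
    cases s <;> simp [chirality, hm]
  refine hb.eq_zero_of_weight hv ?_
  rintro (i | p) hj
  · refine chiralWeight_inl_ne ?_ i hj
    rw [him]; split_ifs <;> norm_num
  · have h := congrArg Complex.im hj
    rw [him, chiralWeight_inr_im] at h
    split_ifs at h <;> norm_num at h

theorem coeff_eq_zero {x y z : ℂ} (h : x • D + y • R + z • Z = 0) : x = 0 ∧ y = 0 ∧ z = 0 := by
  rw [← hb.e_D, ← hb.e_R, ← hb.e_Z] at h
  have h₁ := congrArg (fun v => e.repr v (Sum.inl 1)) h
  have h₃ := congrArg (fun v => e.repr v (Sum.inl 3)) h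
  have h₄ := congrArg (fun v => e.repr v (Sum.inl 4)) h
  simp at h₁ h₃ h₄
  exact ⟨h₁, h₃, h₄⟩

theorem lie_H : ⁅D + R, H⁆ = (2 : ℂ) • H := by simp [hb.DH, hb.RH]
theorem lie_D : ⁅D + R, D⁆ = (0 : ℂ) • D := by simp [hb.RD]
theorem lie_C : ⁅D + R, C⁆ = (-2 : ℂ) • C := by simp [hb.DC, hb.RC]
theorem lie_R : ⁅D + R, R⁆ = (0 : ℂ) • R := by simp [hb.DR]
theorem lie_Z' : ⁅D + R, Z⁆ = (0 : ℂ) • Z := by simp [hb.lie_Z]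
theorem lie_P (s : Bool) (n : ℕ) :
    ⁅D + R, P s n⁆ = ((N : ℂ) - 2 * n + chirality s) • P s n := by
  simp [hb.DP, hb.RP, add_smul]

/-- A weight-zero vector commuting with all chiral vectors is a multiple of the mass. -/
theorem coeff_eq_zero_of_commute {x y z : ℂ} (s : Bool) (hN : 1 ≤ N)
    (h : ∀ n ≤ N, ⁅x • D + y • R + z • Z, P s n⁆ = 0) : x = 0 ∧ y = 0 := by
  have h' : ∀ n ≤ N, x * (N - 2 * n) + y * chirality s = 0 := by
    intro n hn
    have := h n hn
    simp only [add_lie, smul_lie, hb.DP, hb.RP, hb.Z_lie] at this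
    refine (smul_eq_zero.mp ?_).resolve_right (hb.P_ne_zero s hn)
    linear_combination (norm := module) this
  have h₀ := h' 0 (Nat.zero_le _)
  have h₁ := h' 1 hN
  push_cast at h₀ h₁
  have hx : x = 0 := by linear_combination (1 / 2 : ℂ) * h₀ - (1 / 2 : ℂ) * h₁
  refine ⟨hx, ?_⟩
  rw [hx] at h₀
  simpa [chirality_ne_zero] using h₀

end IsChiralBasis

theorem IsAdInvariant.lie_apply {g : Type*} [LieRing g] [LieAlgebra ℂ g] {T a b : g}
    {φ : g → g → g} (hT : IsAdInvariant T φ) (hφ : IsAdCocycle2 φ) {μ ν κ : ℂ}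
    (ha : ⁅T, a⁆ = μ • a) (hb : ⁅T, b⁆ = ν • b) (hκ : μ + ν = κ) :
    ⁅T, φ a b⁆ = κ • φ a b := by
  rw [hT, ha, hb, hφ.smull, hφ.smulr, ← hκ, add_smul]

end ChiralBasis

section Normalized

variable {g : Type*} [LieRing g] [LieAlgebra ℂ g] {N : ℕ}
  {e : Basis (Fin 5 ⊕ Bool × Fin (N + 1)) ℂ g}
  {H D C R Z : g} {P : Bool → ℕ → g} {β : ℕ → ℂ}

/-- Gauge conditions which single out the zero cocycle among the invariant ones. -/
structure IsNormalized (N : ℕ) (H D C R Z : g) (P : Bool → ℕ → g) (φ : g → g → g) :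
    Prop where
  DH : φ D H = 0
  DP : φ D (P true 0) = 0
  RH : φ R H = 0
  RP : ∀ s, φ R (P s 0) = 0
  HC : ∃ y : ℂ, φ H C = y • R
  HP : ∀ s, ∀ n ≤ N, φ H (P s n) = 0
  HZ : φ H Z = 0
  PP : ∃ x : ℂ, φ (P true 0) (P false N) = x • D

namespace IsNormalized

variable {φ : g → g → g} (hn : IsNormalized N H D C R Z P φ)
  (hb : IsChiralBasis N e H D C R Z P β) (hφ : IsAdCocycle2 φ) (hI : IsAdInvariant (D + R) φ)

include hn hb hφ hI

theorem exists_DP (s : Bool) : ∃ p : ℂ, ∀ n ≤ N, φ D (P s n) = p • P s n := by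
  obtain ⟨p, hp⟩ := hb.exists_of_weight_P (Nat.zero_le N)
    (hI.lie_apply hφ hb.lie_D (hb.lie_P s 0) (zero_add _))
  refine ⟨p, fun n => ?_⟩
  induction n with
  | zero => exact fun _ => hp
  | succ n ih =>
    intro hle
    obtain ⟨q, hq⟩ := hb.exists_of_weight_P hle
      (hI.lie_apply hφ hb.lie_D (hb.lie_P s (n + 1)) (zero_add _))
    have h := hφ.cocycle D H (P s (n + 1))
    simp only [hn.HP s _ hle, hn.DH, hq, hb.DH, hb.DP, hb.HP s n hle, hφ.smull,
      hφ.skew_zero (hn.HP s _ hle), hφ.skew D (P s n), ih (Nat.le_of_succ_le hle), lie_zero,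
      lie_smul] at h
    have h' : ((n + 1 : ℂ) * (q - p)) • P s n = 0 := by
      linear_combination (norm := module) h
    have h'' := (smul_eq_zero.mp h').resolve_right (hb.P_ne_zero s (Nat.le_of_succ_le hle))
    have hqp : q = p := sub_eq_zero.mp
      ((mul_eq_zero.mp h'').resolve_left (by exact_mod_cast n.succ_ne_zero))
    rw [hq, hqp]

theorem RP_eq_zero (s : Bool) : ∀ n ≤ N, φ R (P s n) = 0 := by
  intro n
  induction n with
  | zero => exact fun _ => hn.RP s
  | succ n ih =>
    intro hle
    obtain ⟨q, hq⟩ := hb.exists_of_weight_P hle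
      (hI.lie_apply hφ hb.lie_R (hb.lie_P s (n + 1)) (zero_add _))
    have h := hφ.cocycle R H (P s (n + 1))
    simp only [hn.HP s _ hle, hn.RH, hq, hb.RH, hb.RP, hb.HP s n hle, hφ.smull,
      hφ.skew_zero (hn.HP s _ hle), hφ.skew R (P s n), ih (Nat.le_of_succ_le hle), lie_zero,
      lie_smul, hφ.zerol] at h
    have h' : ((n + 1 : ℂ) * q) • P s n = 0 := by
      linear_combination (norm := module) h
    have h'' := (smul_eq_zero.mp h').resolve_right (hb.P_ne_zero s (Nat.le_of_succ_le hle))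
    rw [hq, (mul_eq_zero.mp h'').resolve_left (by exact_mod_cast n.succ_ne_zero), zero_smul]

theorem DC_eq_zero : φ D C = 0 := by
  obtain ⟨x, hx⟩ := hb.exists_of_weight_neg_two
    (hI.lie_apply hφ hb.lie_D hb.lie_C (zero_add _))
  obtain ⟨y, hy⟩ := hn.HC
  have h := hφ.cocycle D H C
  simp only [hy, hx, hn.DH, hb.DH, hb.DC, hb.HC, hb.DR, hφ.smull, hφ.negl, hφ.self, lie_zero,
    lie_smul, hφ.skew H C, smul_neg] at h
  have h' : x • D = 0 := by linear_combination (norm := module) h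
  rw [hx, (smul_eq_zero.mp h').resolve_right hb.D_ne_zero, zero_smul]

theorem RD_eq_zero_and_RC_eq_zero (hN : 1 ≤ N) : φ R D = 0 ∧ φ R C = 0 := by
  obtain ⟨x, y, z, hRD⟩ := hb.exists_of_weight_zero
    (hI.lie_apply hφ hb.lie_R hb.lie_D (zero_add _))
  obtain ⟨w, hRC⟩ := hb.exists_of_weight_neg_two
    (hI.lie_apply hφ hb.lie_R hb.lie_C (zero_add _))
  obtain ⟨p, hp⟩ := hn.exists_DP hb hφ hI true
  have hcomm : ∀ n ≤ N, ⁅x • D + y • R + z • Z, P true n⁆ = 0 := by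
    intro n hle
    have h := hφ.cocycle R D (P true n)
    simp only [hn.RP_eq_zero hb hφ hI true n hle, hp n hle, hb.RD, hb.RP, hb.DP,
      hφ.zerol, hφ.smull, hφ.skew D (P true n), hφ.skew_zero (hn.RP_eq_zero hb hφ hI true n hle),
      lie_zero, lie_smul] at h
    rw [← hRD, ← lie_skew]
    linear_combination (norm := module) -h
  obtain ⟨hx, hy⟩ := hb.coeff_eq_zero_of_commute true hN hcomm
  obtain ⟨v, hv⟩ := hn.HC
  have h := hφ.cocycle R H C
  simp only [hv, hn.RH, hRC, hb.RH, hb.RC, hb.HC, hφ.zerol, hφ.negl, hφ.skew R D, hRD, hx, hy,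
    lie_smul, lie_self, lie_zero] at h
  obtain ⟨hw, -, hz⟩ := hb.coeff_eq_zero (x := w) (y := 0) (z := -z) (by
    linear_combination (norm := module) h)
  rw [hRD, hRC, hx, hy, hw, neg_eq_zero.mp hz]
  simp

theorem exists_CP (y : ℂ) (hy : φ H C = y • R) {s : Bool} {p : ℂ}
    (hp : ∀ n ≤ N, φ D (P s n) = p • P s n) :
    ∀ n < N, φ C (P s n) = (p - y * chirality s) • P s (n + 1) := by
  intro n
  induction n with
  | zero =>
    intro hlt
    obtain ⟨k, hk⟩ := hb.exists_of_weight_P hlt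
      (hI.lie_apply hφ hb.lie_C (hb.lie_P s 0) (by push_cast; ring))
    have h := hφ.cocycle H C (P s 0)
    simp only [hk, hy, hb.HC, hb.HP s 0 hlt, hb.HP_zero, hb.CP, hb.PR, hφ.negl, hφ.smull,
      hp 0 (Nat.zero_le _), hφ.zerol, hφ.skew_zero (hn.HP s _ hlt),
      hn.HP s _ (Nat.zero_le _), lie_smul, lie_zero] at h
    have h' : (p - y * chirality s - k) • P s 0 = 0 := by
      push_cast at h
      linear_combination (norm := module) h
    rw [hk, sub_eq_zero.mp ((smul_eq_zero.mp h').resolve_right (hb.P_ne_zero s (Nat.zero_le _)))]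
  | succ n ih =>
    intro hlt
    obtain ⟨k, hk⟩ := hb.exists_of_weight_P hlt
      (hI.lie_apply hφ hb.lie_C (hb.lie_P s (n + 1)) (by push_cast; ring))
    have h := hφ.cocycle H C (P s (n + 1))
    have hn' := (Nat.lt_succ_self n).trans hlt
    simp only [hk, hy, hb.HC, hb.HP s _ hlt, hb.HP s _ hn', hb.CP, hb.PR, hφ.negl, hφ.smull,
      hp _ hlt.le, hφ.skew C (P s n), ih hn', hφ.skew_zero (hn.HP s _ hlt),
      hn.HP s _ hlt.le, lie_smul, lie_zero] at h
    have h' : ((n + 2 : ℂ) * (p - y * chirality s - k)) • P s (n + 1) = 0 := by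
      linear_combination (norm := module) h
    have h'' := (mul_eq_zero.mp ((smul_eq_zero.mp h').resolve_right
      (hb.P_ne_zero s hlt.le))).resolve_left (by exact_mod_cast (n + 1).succ_ne_zero)
    rw [hk, sub_eq_zero.mp h'']

theorem eq_mul_chirality (hN : 1 ≤ N) (y : ℂ) (hy : φ H C = y • R) {s : Bool} {p : ℂ}
    (hp : ∀ n ≤ N, φ D (P s n) = p • P s n) : p = y * chirality s := by
  obtain ⟨n, rfl⟩ := Nat.exists_eq_add_of_le' hN
  have hCP : φ C (P s (n + 1)) = 0 := by
    refine hb.eq_zero_of_weight_P (s := s) (m := -((n + 1 : ℕ) : ℤ) - 2)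
      (hI.lie_apply hφ hb.lie_C (hb.lie_P s _) (by push_cast; ring)) (Or.inl (by omega))
  have h := hφ.cocycle H C (P s (n + 1))
  simp only [hCP, hy, hb.HC, hb.HP s _ n.lt_succ_self, hb.CP, hb.PR, hφ.negl, hφ.smull,
    hp _ le_rfl, hφ.skew C (P s n), hn.exists_CP hb hφ hI y hy hp n n.lt_succ_self,
    hb.P_eq_zero s _ (n + 1).lt_succ_self, hφ.zerol, smul_zero,
    hn.HP s _ le_rfl, lie_smul, lie_zero] at h
  have h' : ((n + 2 : ℂ) * (p - y * chirality s)) • P s (n + 1) = 0 := by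
    linear_combination (norm := module) h
  exact sub_eq_zero.mp ((mul_eq_zero.mp ((smul_eq_zero.mp h').resolve_right
    (hb.P_ne_zero s le_rfl))).resolve_left (by exact_mod_cast (n + 1).succ_ne_zero))

theorem HC_eq_zero (hN : 1 ≤ N) : φ H C = 0 := by
  obtain ⟨y, hy⟩ := hn.HC
  obtain ⟨p, hp⟩ := hn.exists_DP hb hφ hI true
  have h := hn.eq_mul_chirality hb hφ hI hN y hy hp
  have hp₀ : p • P true 0 = 0 := by rw [← hp 0 (Nat.zero_le _), hn.DP]
  rw [(smul_eq_zero.mp hp₀).resolve_right (hb.P_ne_zero _ (Nat.zero_le _))] at h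
  rw [hy, (mul_eq_zero.mp h.symm).resolve_right (chirality_ne_zero _), zero_smul]

theorem DP_eq_zero (hN : 1 ≤ N) (s : Bool) : ∀ n ≤ N, φ D (P s n) = 0 := by
  intro n hle
  obtain ⟨p, hp⟩ := hn.exists_DP hb hφ hI s
  have h := hn.eq_mul_chirality hb hφ hI hN 0
    (by rw [hn.HC_eq_zero hb hφ hI hN, zero_smul]) hp
  rw [hp n hle, h, zero_mul, zero_smul]

theorem CP_eq_zero (hN : 1 ≤ N) (s : Bool) : ∀ n ≤ N, φ C (P s n) = 0 := by
  intro n hle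
  rcases hle.lt_or_eq with hlt | rfl
  · rw [hn.exists_CP hb hφ hI 0 (by rw [hn.HC_eq_zero hb hφ hI hN, zero_smul]) (p := 0)
      (fun n hle => by rw [hn.DP_eq_zero hb hφ hI hN s n hle, zero_smul]) n hlt]
    simp
  · refine hb.eq_zero_of_weight_P (s := s) (m := -(n : ℤ) - 2)
      (hI.lie_apply hφ hb.lie_C (hb.lie_P s _) (by push_cast; ring)) (Or.inl (by omega))

theorem DZ_eq_zero_and_CZ_eq_zero (hN : Odd N) : φ D Z = 0 ∧ φ C Z = 0 := by
  obtain ⟨w, hw⟩ := hb.exists_of_weight_neg_two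
    (hI.lie_apply hφ hb.lie_C hb.lie_Z' (add_zero _))
  obtain ⟨q, hq⟩ := hb.exists_of_weight_P (Nat.zero_le N)
    (hI.lie_apply hφ hb.lie_Z' (hb.lie_P true 0) (zero_add _))
  have h₁ := hφ.cocycle C H Z
  simp only [hw, hn.HZ, hb.lie_Z, hb.Z_lie, hb.CH, hb.HC, lie_zero, lie_smul, hφ.zerol] at h₁
  have hD : φ D Z = w • D := by linear_combination (norm := module) -h₁
  have h₂ := hφ.cocycle D Z (P true 0)
  simp only [hq, hD, hb.lie_Z, hb.Z_lie, hb.DP, hb.PD, lie_smul, hφ.zerol, hφ.smull,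
    hφ.skew Z (P true 0)] at h₂
  have hNpos : (N : ℂ) ≠ 0 := by exact_mod_cast hN.pos.ne'
  have h₃ : ((N : ℂ) * w) • P true 0 = 0 := by
    push_cast at h₂
    linear_combination (norm := module) -h₂
  have hw₀ := (mul_eq_zero.mp ((smul_eq_zero.mp h₃).resolve_right
    (hb.P_ne_zero _ (Nat.zero_le _)))).resolve_left hNpos
  rw [hD, hw, hw₀, zero_smul, zero_smul]
  exact ⟨rfl, rfl⟩

theorem exists_ZP (s : Bool) : ∃ q : ℂ, ∀ n ≤ N, φ Z (P s n) = q • P s n := by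
  obtain ⟨q, hq⟩ := hb.exists_of_weight_P (Nat.zero_le N)
    (hI.lie_apply hφ hb.lie_Z' (hb.lie_P s 0) (zero_add _))
  refine ⟨q, fun n => ?_⟩
  induction n with
  | zero => exact fun _ => hq
  | succ n ih =>
    intro hle
    obtain ⟨r, hr⟩ := hb.exists_of_weight_P hle
      (hI.lie_apply hφ hb.lie_Z' (hb.lie_P s (n + 1)) (zero_add _))
    have h := hφ.cocycle H Z (P s (n + 1))
    simp only [hr, hn.HZ, hb.lie_Z, hb.Z_lie, hb.HP s n hle, hφ.smull, hφ.skew Z (P s n),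
      ih (Nat.le_of_succ_le hle), lie_zero, lie_smul, hφ.zerol] at h
    have h' : ((n + 1 : ℂ) * (r - q)) • P s n = 0 := by
      linear_combination (norm := module) -h
    have h'' := (smul_eq_zero.mp h').resolve_right (hb.P_ne_zero s (Nat.le_of_succ_le hle))
    rw [hr, sub_eq_zero.mp
      ((mul_eq_zero.mp h'').resolve_left (by exact_mod_cast n.succ_ne_zero))]

theorem RZ_eq_zero : φ R Z = 0 := by
  obtain ⟨v, hv⟩ := hn.PP
  have h := hφ.cocycle R (P true 0) (P false N)
  simp only [hv, hn.RP_eq_zero hb hφ hI _ _ le_rfl, hn.RP_eq_zero hb hφ hI _ _ (Nat.zero_le _),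
    hb.RP, hb.RD, hb.PP, hφ.smull, hφ.skew (P true 0) (P false N), hφ.skew R Z, lie_smul,
    lie_zero, chirality] at h
  have h' : β 0 • φ R Z = 0 := by
    simp only [ne_eq, Bool.true_eq_false, not_false_eq_true, zero_add, and_self, if_true] at h
    linear_combination (norm := module) h
  exact (smul_eq_zero.mp h').resolve_left hb.β_zero

omit hn in
theorem apply_PP_eq_zero_of_lt {s t : Bool} {m n : ℕ} (h : m + n + 1 < N) :
    φ (P s m) (P t n) = 0 := by
  by_cases hst : s = t
  · subst hst
    exact hb.eq_zero_of_weight_two_chirality (m := (N - 2 * m) + (N - 2 * n)) (s := s) (by simp)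
      (hI.lie_apply hφ (hb.lie_P s m) (hb.lie_P s n) (by ring))
  · have hc : chirality s + chirality t = 0 := by
      cases s <;> cases t <;> simp [chirality] at hst ⊢
    refine hb.eq_zero_of_large_weight (m := 2 * N - 2 * m - 2 * n)
      (hI.lie_apply hφ (hb.lie_P s m) (hb.lie_P t n) ?_) (Or.inr (by omega))
    push_cast
    linear_combination hc

omit hn in
theorem apply_PP_same (s : Bool) (m n : ℕ) : φ (P s m) (P s n) = 0 :=
  hb.eq_zero_of_weight_two_chirality (m := (N - 2 * m) + (N - 2 * n)) (s := s) (by simp)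
    (hI.lie_apply hφ (hb.lie_P s m) (hb.lie_P s n) (by ring))

omit hn in
theorem lie_apply_PP (hN : 3 ≤ N) (s : Bool) {k : ℕ} (hk : k ≤ 1) :
    ⁅P s k, φ (P s N) (P (!s) 0)⁆ = β N • φ Z (P s k) := by
  have h := hφ.cocycle (P s k) (P s N) (P (!s) 0)
  have hkN : k ≠ N := by omega
  simp only [apply_PP_eq_zero_of_lt hb hφ hI (s := s) (t := !s) (m := k) (n := 0) (by omega),
    apply_PP_same hb hφ hI, hb.PP_same, hb.PP, add_zero, hkN, and_false, if_false, zero_smul,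
    lie_zero, hφ.zerol, hφ.smull] at h
  simp only [ne_eq, Bool.eq_not_self, not_false_eq_true, and_self, if_true] at h
  linear_combination (norm := module) h

theorem apply_PP_first_last (hN : 3 ≤ N) : φ (P true 0) (P false N) = 0 := by
  obtain ⟨x, hx⟩ := hn.PP
  obtain ⟨q, hq⟩ := hn.exists_ZP hb hφ hI false
  have key : ∀ k : ℕ, k ≤ 1 → x * (N - 2 * k) = β N * q := by
    intro k hk
    have h := lie_apply_PP hb hφ hI hN false hk
    rw [Bool.not_false, hφ.skew (P true 0), hx, lie_neg, lie_smul, hb.PD, hq k (by omega)] at h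
    refine sub_eq_zero.mp ((smul_eq_zero.mp ?_).resolve_right
      (hb.P_ne_zero false (n := k) (by omega)))
    linear_combination (norm := module) h
  have h₀ := key 0 (by norm_num)
  have h₁ := key 1 le_rfl
  push_cast at h₀ h₁
  have hx₀ : x = 0 := by linear_combination (1 / 2 : ℂ) * h₀ - (1 / 2 : ℂ) * h₁
  rw [hx, hx₀, zero_smul]

theorem apply_PP_first (hN : 3 ≤ N) (k : ℕ) : φ (P true 0) (P false k) = 0 := by
  rcases lt_trichotomy k N with hlt | rfl | hlt
  · rcases (Nat.succ_le_of_lt hlt).lt_or_eq with hlt' | rfl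
    · exact apply_PP_eq_zero_of_lt hb hφ hI (by simpa using hlt')
    · have h := hφ.cocycle H (P true 0) (P false (k + 1))
      simp only [hn.apply_PP_first_last hb hφ hI hN, hn.HP _ _ le_rfl, hn.HP _ _ (Nat.zero_le _),
        hb.HP_zero, hb.HP _ k hlt, hb.PP, hφ.zerol, hφ.smull, hφ.skew_zero hn.HZ,
        hφ.skew (P true 0) (P false k), lie_zero] at h
      have h' : (k + 1 : ℂ) • φ (P true 0) (P false k) = 0 := by
        linear_combination (norm := module) h
      exact (smul_eq_zero.mp h').resolve_left (by exact_mod_cast k.succ_ne_zero)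
  · exact hn.apply_PP_first_last hb hφ hI hN
  · rw [hb.P_eq_zero _ _ hlt, hφ.zeror]

theorem apply_PP_true_false (hN : Odd N) (hN3 : 3 ≤ N) (k : ℕ) :
    ∀ m n, m + n = k → φ (P true m) (P false n) = 0 := by
  have hC : ∀ s n, φ C (P s n) = 0 := by
    intro s n
    rcases le_or_gt n N with h | h
    · exact hn.CP_eq_zero hb hφ hI (by omega) s n h
    · rw [hb.P_eq_zero _ _ h, hφ.zeror]
  induction k with
  | zero =>
    intro m n hmn
    obtain ⟨rfl, rfl⟩ := Nat.add_eq_zero_iff.mp hmn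
    exact hn.apply_PP_first hb hφ hI hN3 0
  | succ k ih =>
    intro m
    induction m with
    | zero => exact fun n _ => hn.apply_PP_first hb hφ hI hN3 n
    | succ m ihm =>
      intro n hmn
      rcases lt_or_ge m N with hlt | hge
      · have h := hφ.cocycle C (P true m) (P false n)
        simp only [ih m n (by omega), hC, hb.CP, hb.PP, hφ.smull,
          hφ.skew_zero (hn.DZ_eq_zero_and_CZ_eq_zero hb hφ hI hN).2,
          hφ.skew_zero (ihm (n + 1) (by omega)), lie_zero] at h
        have h' : ((N : ℂ) - m) • φ (P true (m + 1)) (P false n) = 0 := by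
          linear_combination (norm := module) -h
        exact (smul_eq_zero.mp h').resolve_left
          (sub_ne_zero.mpr (by exact_mod_cast hlt.ne'))
      · rw [hb.P_eq_zero _ _ (Nat.lt_succ_of_le hge), hφ.zerol]

theorem ZP_eq_zero (hN : Odd N) (hN3 : 3 ≤ N) (s : Bool) : ∀ n ≤ N, φ Z (P s n) = 0 := by
  obtain ⟨q, hq⟩ := hn.exists_ZP hb hφ hI s
  have hu : φ (P s N) (P (!s) 0) = 0 := by
    cases s
    · exact hφ.skew_zero (hn.apply_PP_true_false hb hφ hI hN hN3 _ _ _ rfl)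
    · exact hn.apply_PP_true_false hb hφ hI hN hN3 _ _ _ rfl
  have h := lie_apply_PP hb hφ hI hN3 s (k := 0) (by norm_num)
  rw [hu, lie_zero, hq 0 (Nat.zero_le _)] at h
  have hq₀ := (smul_eq_zero.mp ((smul_eq_zero.mp h.symm).resolve_left hb.β_last)).resolve_right
    (hb.P_ne_zero s (Nat.zero_le _))
  intro n hle
  rw [hq n hle, hq₀, zero_smul]

theorem apply_PP_eq_zero (hN : Odd N) (hN3 : 3 ≤ N) (s t : Bool) (m n : ℕ) :
    φ (P s m) (P t n) = 0 := by
  cases s <;> cases t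
  · exact apply_PP_same hb hφ hI _ _ _
  · exact hφ.skew_zero (hn.apply_PP_true_false hb hφ hI hN hN3 _ _ _ rfl)
  · exact hn.apply_PP_true_false hb hφ hI hN hN3 _ _ _ rfl
  · exact apply_PP_same hb hφ hI _ _ _

theorem eq_zero (hN : Odd N) (hN3 : 3 ≤ N) (a b : g) : φ a b = 0 := by
  have hN1 : 1 ≤ N := by omega
  have hHC := hn.HC_eq_zero hb hφ hI hN1
  have hDC := hn.DC_eq_zero hb hφ hI
  have hDP := hn.DP_eq_zero hb hφ hI hN1
  have hCP := hn.CP_eq_zero hb hφ hI hN1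
  have hRP := hn.RP_eq_zero hb hφ hI
  have hZP := hn.ZP_eq_zero hb hφ hI hN hN3
  have hRZ := hn.RZ_eq_zero hb hφ hI
  obtain ⟨hRD, hRC⟩ := hn.RD_eq_zero_and_RC_eq_zero hb hφ hI hN1
  obtain ⟨hDZ, hCZ⟩ := hn.DZ_eq_zero_and_CZ_eq_zero hb hφ hI hN
  have hPP := hn.apply_PP_eq_zero hb hφ hI hN hN3
  exact hb.ext_skew hφ.bilin hφ.skew (hφ.skew_zero hn.DH) hHC (hφ.skew_zero hn.RH) hn.HZ hn.HP
    hDC (hφ.skew_zero hRD) hDZ hDP (hφ.skew_zero hRC) hCZ hCP hRZ hRP hZP hPP a b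

end IsNormalized
end Normalized

section Gauge

variable {g : Type*} [LieRing g] [LieAlgebra ℂ g] {N : ℕ}
  {e : Basis (Fin 5 ⊕ Bool × Fin (N + 1)) ℂ g}
  {H D C R Z : g} {P : Bool → ℕ → g} {β : ℕ → ℂ}

/-- The linear map with prescribed values on a chiral basis. -/
def chiralMap (e : Basis (Fin 5 ⊕ Bool × Fin (N + 1)) ℂ g) (w : Fin 5 → g)
    (p : Bool → ℕ → g) : g →ₗ[ℂ] g :=
  e.constr ℂ (Sum.elim w fun q => p q.1 q.2)

theorem cob_add (ω₁ ω₂ : g →ₗ[ℂ] g) (a b : g) :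
    cob (ω₁ + ω₂) a b = cob ω₁ a b + cob ω₂ a b := by
  simp only [cob, LinearMap.add_apply, lie_add]
  abel

namespace IsChiralBasis

variable (hb : IsChiralBasis N e H D C R Z P β)

include hb

theorem chiralMap_H (w : Fin 5 → g) (p : Bool → ℕ → g) : chiralMap e w p H = w 0 := by
  rw [← hb.e_H]; simp [chiralMap]
theorem chiralMap_D (w : Fin 5 → g) (p : Bool → ℕ → g) : chiralMap e w p D = w 1 := by
  rw [← hb.e_D]; simp [chiralMap]
theorem chiralMap_C (w : Fin 5 → g) (p : Bool → ℕ → g) : chiralMap e w p C = w 2 := by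
  rw [← hb.e_C]; simp [chiralMap]
theorem chiralMap_R (w : Fin 5 → g) (p : Bool → ℕ → g) : chiralMap e w p R = w 3 := by
  rw [← hb.e_R]; simp [chiralMap]
theorem chiralMap_Z (w : Fin 5 → g) (p : Bool → ℕ → g) : chiralMap e w p Z = w 4 := by
  rw [← hb.e_Z]; simp [chiralMap]
theorem chiralMap_P (w : Fin 5 → g) (p : Bool → ℕ → g) (hp : ∀ s n, N < n → p s n = 0)
    (s : Bool) (n : ℕ) : chiralMap e w p (P s n) = p s n := by
  rcases le_or_gt n N with h | h
  · rw [← hb.e_P s h]; simp [chiralMap]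
  · rw [hb.P_eq_zero s n h, hp s n h, map_zero]

theorem exists_HP (s : Bool) (n : ℕ) (hn : n ≤ N) : ∃ (x : ℂ) (m : ℕ), ⁅H, P s n⁆ = x • P s m := by
  cases n with
  | zero => exact ⟨0, 0, by rw [hb.HP_zero, zero_smul]⟩
  | succ n => exact ⟨_, n, hb.HP s n hn⟩

/-- The grading derivation, acting by one on the chiral vectors and by two on the mass. -/
theorem exists_grading : ∃ E : g →ₗ[ℂ] g, E H = 0 ∧ E D = 0 ∧ E C = 0 ∧ E R = 0 ∧
    E Z = (2 : ℂ) • Z ∧ (∀ s n, E (P s n) = P s n) ∧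
    ∀ a b : g, E ⁅a, b⁆ = ⁅a, E b⁆ + ⁅E a, b⁆ := by
  let E := chiralMap e ![0, 0, 0, 0, (2 : ℂ) • Z] P
  have EH : E H = 0 := hb.chiralMap_H _ _
  have ED : E D = 0 := hb.chiralMap_D _ _
  have EC : E C = 0 := hb.chiralMap_C _ _
  have ER : E R = 0 := hb.chiralMap_R _ _
  have EZ : E Z = (2 : ℂ) • Z := hb.chiralMap_Z _ _
  have EP : ∀ s n, E (P s n) = P s n := hb.chiralMap_P _ _ hb.P_eq_zero
  refine ⟨E, EH, ED, EC, ER, EZ, EP, fun a b => ?_⟩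
  have h : cob E a b = 0 := by
    refine hb.ext_skew (isAdCocycle2_cob E).bilin (isAdCocycle2_cob E).skew
      ?_ ?_ ?_ ?_ ?_ ?_ ?_ ?_ ?_ ?_ ?_ ?_ ?_ ?_ ?_ ?_ a b
    case refine_5 =>
      intro s n hn
      obtain ⟨x, m, h⟩ := hb.exists_HP s n hn
      change cob E H (P s n) = 0
      simp [cob, EH, EP, h]
    case refine_16 =>
      intro s t m n
      change cob E (P s m) (P t n) = 0
      rw [cob, EP, EP, ← lie_skew (P s m) (P t n), hb.PP, map_neg, map_smul, EZ]
      module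
    all_goals
      intros
      simp [IsAdCocycle2.bilin, cob, EH, ED, EC, ER, EZ, EP, hb.HD, hb.HC, hb.HR, hb.DC, hb.DR,
        hb.CR, hb.DP, hb.CP, hb.RP, hb.lie_Z, hb.Z_lie]
  rw [cob, ← lie_skew b] at h
  linear_combination (norm := module) -h

theorem coord_R_lie (a b : g) : e.coord (Sum.inl 3) ⁅a, b⁆ = 0 := by
  have rH : e.coord (Sum.inl 3) H = 0 := by rw [← hb.e_H]; simp
  have rD : e.coord (Sum.inl 3) D = 0 := by rw [← hb.e_D]; simp
  have rC : e.coord (Sum.inl 3) C = 0 := by rw [← hb.e_C]; simp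
  have rZ : e.coord (Sum.inl 3) Z = 0 := by rw [← hb.e_Z]; simp
  have rP : ∀ s n, e.coord (Sum.inl 3) (P s n) = 0 := by
    intro s n
    rcases le_or_gt n N with h | h
    · rw [← hb.e_P s h]; simp
    · rw [hb.P_eq_zero s n h, map_zero]
  let φ : g →ₗ[ℂ] g →ₗ[ℂ] ℂ := LinearMap.mk₂ ℂ (fun a b => e.coord (Sum.inl 3) ⁅a, b⁆)
    (fun a b c => by rw [add_lie, map_add]) (fun t a b => by rw [smul_lie, map_smul])
    (fun a b c => by rw [lie_add, map_add]) (fun t a b => by rw [lie_smul, map_smul])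
  refine hb.ext_skew φ (fun a b => ?_) ?_ ?_ ?_ ?_ ?_ ?_ ?_ ?_ ?_ ?_ ?_ ?_ ?_ ?_ ?_ ?_ a b
  · change e.coord _ ⁅b, a⁆ = - e.coord _ ⁅a, b⁆
    rw [← lie_skew, map_neg]
  case refine_6 =>
    intro s n hn
    obtain ⟨x, m, h⟩ := hb.exists_HP s n hn
    change e.coord _ ⁅H, P s n⁆ = 0
    rw [h, map_smul, rP, smul_zero]
  all_goals
    intros
    simp only [φ, LinearMap.mk₂_apply, map_smul, map_neg, map_zero, rH, rD, rC, rZ, rP, hb.HD,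
      hb.HC, hb.HR, hb.DC, hb.DR, hb.CR, hb.DP, hb.CP, hb.RP, hb.PP, hb.lie_Z, hb.Z_lie,
      smul_zero, neg_zero]

theorem coord_Z_lie_R (v : g) : e.coord (Sum.inl 4) ⁅R, v⁆ = 0 := by
  refine hb.ext_map (f := e.coord (Sum.inl 4) ∘ₗ (LieAlgebra.ad ℂ g R : g →ₗ[ℂ] g))
    ?_ ?_ ?_ ?_ ?_ ?_ v
  case refine_6 =>
    intro s n hn
    rw [LinearMap.comp_apply, LieAlgebra.ad_apply, hb.RP, map_smul, ← hb.e_P s hn]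
    simp
  all_goals simp [hb.RH, hb.RD, hb.RC, hb.lie_Z]

/-- An invariant cocycle can be normalized by a coboundary and a multiple of a cocycle `ψ`
pairing the rotation with the grading derivation. -/
theorem exists_isNormalized {φ ψ : g → g → g} (hφ : IsAdCocycle2 φ)
    (hI : IsAdInvariant (D + R) φ) (ψRP : ∀ s n, ψ R (P s n) = P s n) (ψRH : ψ R H = 0)
    (ψ_zero : ∀ a b, e.coord (Sum.inl 3) a = 0 → e.coord (Sum.inl 3) b = 0 → ψ a b = 0) :
    ∃ (c : ℂ) (ω : g →ₗ[ℂ] g), (∀ x, ω ⁅D + R, x⁆ = ⁅D + R, ω x⁆) ∧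
      IsNormalized N H D C R Z P (fun a b => φ a b - c • ψ a b - cob ω a b) := by
  have rH : e.coord (Sum.inl 3) H = 0 := by rw [← hb.e_H]; simp
  have rD : e.coord (Sum.inl 3) D = 0 := by rw [← hb.e_D]; simp
  have rC : e.coord (Sum.inl 3) C = 0 := by rw [← hb.e_C]; simp
  have rZ : e.coord (Sum.inl 3) Z = 0 := by rw [← hb.e_Z]; simp
  have rP : ∀ s, ∀ n ≤ N, e.coord (Sum.inl 3) (P s n) = 0 := fun s n h => by
    rw [← hb.e_P s h]; simp
  obtain ⟨a, ha⟩ := hb.exists_of_weight_two (hI.lie_apply hφ hb.lie_D hb.lie_H (zero_add _))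
  obtain ⟨b, hbb⟩ := hb.exists_of_weight_P (Nat.zero_le N)
    (hI.lie_apply hφ hb.lie_D (hb.lie_P true 0) (zero_add _))
  obtain ⟨r, hr⟩ := hb.exists_of_weight_two (hI.lie_apply hφ hb.lie_R hb.lie_H (zero_add _))
  have hρ : ∀ s, ∃ ρ : ℂ, φ R (P s 0) = ρ • P s 0 := fun s =>
    hb.exists_of_weight_P (Nat.zero_le N)
      (hI.lie_apply hφ hb.lie_R (hb.lie_P s 0) (zero_add _))
  choose ρ hρ using hρ
  obtain ⟨x, y, z, hxyz⟩ := hb.exists_of_weight_zero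
    (hI.lie_apply hφ hb.lie_H hb.lie_C (by ring))
  obtain ⟨m, hm⟩ := hb.exists_of_weight_two (hI.lie_apply hφ hb.lie_H hb.lie_Z' (add_zero _))
  obtain ⟨u, v, w, huvw⟩ := hb.exists_of_weight_zero
    (hI.lie_apply hφ (hb.lie_P true 0) (hb.lie_P false N) (by simp [chirality]; ring))
  have hη : ∀ s n, ∃ η : ℂ, n < N → φ H (P s (n + 1)) = η • P s n := by
    intro s n
    by_cases hn : n < N
    · obtain ⟨η, h⟩ := hb.exists_of_weight_P hn.le
        (hI.lie_apply hφ hb.lie_H (hb.lie_P s (n + 1)) (by push_cast; ring))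
      exact ⟨η, fun _ => h⟩
    · exact ⟨0, fun h => absurd h hn⟩
  choose η hη using hη
  have hHP₀ : ∀ s, φ H (P s 0) = 0 := fun s =>
    hb.eq_zero_of_weight_P (s := s) (m := N + 2)
      (hI.lie_apply hφ hb.lie_H (hb.lie_P s 0) (by push_cast; ring)) (Or.inr (by omega))
  let p : Bool → ℕ → ℂ := fun s n => -∑ k ∈ Finset.range n, η s k / (k + 1)
  have p_zero : ∀ s, p s 0 = 0 := fun s => by simp [p]
  have p_succ : ∀ s n, p s (n + 1) = p s n - η s n / (n + 1) := fun s n => by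
    simp only [p, Finset.sum_range_succ]; ring
  have hI0 : Complex.I ≠ 0 := Complex.I_ne_zero
  let d₂ : ℂ := (b - a / 2 * N) / Complex.I
  let r₂ : ℂ := (ρ true - ρ false) / (2 * Complex.I)
  let c : ℂ := (ρ true + ρ false) / 2 - r / 2 * N
  let ωD : g := (a / 2) • D + d₂ • R + z • Z
  let ωR : g := (r / 2) • D + r₂ • R
  let ωZ : g := (-m / 2) • D + (-v / β 0) • R + (p false N - w / β 0) • Z
  let ω := chiralMap e ![0, ωD, (a / 2 - x) • C, ωR, ωZ] (fun s n => p s n • P s n)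
  have ωH' : ω H = 0 := hb.chiralMap_H _ _
  have ωD' : ω D = (a / 2) • D + d₂ • R + z • Z := hb.chiralMap_D _ _
  have ωC' : ω C = (a / 2 - x) • C := hb.chiralMap_C _ _
  have ωR' : ω R = (r / 2) • D + r₂ • R := hb.chiralMap_R _ _
  have ωZ' : ω Z = (-m / 2) • D + (-v / β 0) • R + (p false N - w / β 0) • Z :=
    hb.chiralMap_Z _ _
  have ωP : ∀ s n, ω (P s n) = p s n • P s n := hb.chiralMap_P _ _ fun s n h => by
    rw [hb.P_eq_zero s n h, smul_zero]
  have hN0 := Nat.zero_le N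
  refine ⟨c, ω, ?_, ?_⟩
  · intro t
    have := hb.ext_map (f := ω ∘ₗ (LieAlgebra.ad ℂ g (D + R) : g →ₗ[ℂ] g)
      - (LieAlgebra.ad ℂ g (D + R) : g →ₗ[ℂ] g) ∘ₗ ω) ?_ ?_ ?_ ?_ ?_ ?_ t
    · exact sub_eq_zero.mp this
    case refine_6 =>
      intro s n _
      simp only [LinearMap.sub_apply, LinearMap.comp_apply, LieAlgebra.ad_apply, hb.lie_P, ωP,
        map_smul]
      module
    all_goals
      simp only [LinearMap.sub_apply, LinearMap.comp_apply, LieAlgebra.ad_apply, hb.lie_H,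
        hb.lie_D, hb.lie_C, hb.lie_R, hb.lie_Z', ωH', ωD', ωC', ωR', ωZ', map_smul, lie_smul,
        lie_add, lie_zero]
      module
  · refine ⟨?_, ?_, ?_, ?_, ⟨y - d₂, ?_⟩, ?_, ?_, ⟨u + β 0 * (-m / 2), ?_⟩⟩
    · rw [ψ_zero _ _ rD rH, ha]
      simp only [cob, ωH', ωD', lie_zero, lie_add, lie_smul, hb.HD, hb.HR, hb.lie_Z, hb.DH,
        map_smul]
      module
    · rw [ψ_zero _ _ rD (rP _ _ hN0), hbb]
      simp only [cob, ωP, ωD', lie_add, lie_smul, hb.PD, hb.PR, hb.lie_Z, hb.DP, map_smul]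
      have : b = a / 2 * N + chirality true * d₂ := by
        simp only [d₂, chirality]; field_simp; ring
      rw [this]
      push_cast
      module
    · rw [ψRH, hr]
      simp only [cob, ωH', ωR', lie_zero, lie_add, lie_smul, hb.HD, hb.HR, hb.RH, map_zero]
      module
    · intro s
      rw [ψRP, hρ]
      simp only [cob, ωP, ωR', lie_add, lie_smul, hb.PD, hb.PR, hb.RP, map_smul]
      have : ρ s = c + r / 2 * N + chirality s * r₂ := by
        cases s <;> simp only [r₂, c, chirality] <;> field_simp <;> ring
      rw [this]
      push_cast
      module
    · rw [ψ_zero _ _ rH rC, hxyz]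
      simp only [cob, ωH', ωC', lie_zero, lie_smul, hb.HC, map_neg, ωD']
      module
    · intro s n hn
      rw [ψ_zero _ _ rH (rP s n hn)]
      cases n with
      | zero => simp [cob, ωH', ωP, hHP₀, hb.HP_zero]
      | succ n =>
        have hn' : (n + 1 : ℂ) ≠ 0 := by exact_mod_cast n.succ_ne_zero
        rw [hη s n hn]
        simp only [cob, ωH', ωP, lie_smul, lie_zero, hb.HP s n hn, map_smul, p_succ]
        have : η s n = (n + 1) * (η s n / (n + 1)) := by field_simp
        nth_rewrite 1 [this]
        module
    · rw [ψ_zero _ _ rH rZ, hm]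
      simp only [cob, ωH', ωZ', hb.lie_Z, lie_add, lie_smul, lie_zero, hb.HD, hb.HR, map_zero]
      module
    · rw [ψ_zero _ _ (rP _ _ hN0) (rP _ _ le_rfl), huvw]
      have hPP : ⁅P true 0, P false N⁆ = β 0 • Z := by simp [hb.PP]
      have hPP' : ⁅P false N, P true 0⁆ = -(β 0 • Z) := by rw [← lie_skew, hPP]
      simp only [cob, ωP, lie_smul, hPP, hPP', map_smul, ωZ', p_zero]
      have hβ := hb.β_zero
      match_scalars <;> field_simp <;> ring

/-- The cohomology is spanned by the class pairing the rotation with the grading derivation. -/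
theorem h2Dim1 (hN : Odd N) (hN3 : 3 ≤ N) : H2Dim1 g := by
  obtain ⟨E, EH, ED, EC, ER, EZ, EP, hE⟩ := hb.exists_grading
  set r := e.coord (Sum.inl 3) with hr
  have rR : r R = 1 := by rw [hr, ← hb.e_R]; simp
  have rH : r H = 0 := by rw [hr, ← hb.e_H]; simp
  have rZ : r Z = 0 := by rw [hr, ← hb.e_Z]; simp
  have hψ := isAdCocycle2_wedge hb.coord_R_lie hE
  refine ⟨fun a b => r a • E b - r b • E a, hψ, fun ω hω => ?_, fun φ hφ => ?_⟩
  · have h := hω R Z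
    simp only [rR, rZ, EZ, cob, hb.lie_Z, hb.Z_lie, map_zero, zero_smul, one_smul, sub_zero] at h
    have h' := congrArg (e.coord (Sum.inl 4)) h
    rw [hb.coord_Z_lie_R, ← hb.e_Z] at h'
    simp at h'
  · obtain ⟨ω₁, h₁⟩ := hφ.exists_isAdInvariant e hb.lie_basis
    have hφ₁ := hφ.sub (isAdCocycle2_cob ω₁)
    have rP : ∀ s n, r (P s n) = 0 := by
      intro s n
      have h := hb.coord_R_lie R (P s n)
      rw [hb.RP, map_smul] at h
      exact (smul_eq_zero.mp h).resolve_left (chirality_ne_zero s)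
    obtain ⟨c, ω₂, hω₂, h₂⟩ := hb.exists_isNormalized (ψ := fun a b => r a • E b - r b • E a)
      hφ₁ h₁ (fun s n => by simp [rR, EP, rP]) (by simp [EH, rH, ER])
      (fun a b ha hb => by simp only [hr, ha, hb]; simp)
    have hψI : IsAdInvariant (D + R) (fun a b => r a • E b - r b • E a) := by
      intro a b
      have h₁ : ∀ x, E ⁅D + R, x⁆ = ⁅D + R, E x⁆ := fun x => by
        rw [hE, map_add, ED, ER, add_zero, zero_lie, add_zero]
      simp only [h₁, hr, hb.coord_R_lie, lie_sub, lie_smul]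
      module
    have hI := (h₁.sub (hψI.smul c)).sub (isAdInvariant_cob hω₂)
    have hC := (hφ₁.sub (hψ.smul c)).sub (isAdCocycle2_cob ω₂)
    refine ⟨c, ω₁ + ω₂, fun a b => ?_⟩
    have h := h₂.eq_zero hb hC hI hN hN3 a b
    rw [cob_add]
    linear_combination (norm := module) h

end IsChiralBasis

end Gauge

section Presentation

variable {g : Type*} [LieRing g] [LieAlgebra ℂ g] {N : ℕ} {H D C : g}
  {M : Fin 2 → Fin 2 → g} {P : ℕ → Fin 2 → g} {Mc : g}

theorem bcoef_ne_zero (N m : ℕ) : bcoef N m ≠ 0 := by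
  simp [bcoef, Nat.factorial_ne_zero]

/-- The chiral combinations of the vectors `P_{n,1}` and `P_{n,2}`. -/
def chiralP (P : ℕ → Fin 2 → g) (s : Bool) (n : ℕ) : g := P n 0 + chirality s • P n 1

namespace IsCGAHat

variable (hg : IsCGAHat 2 N H D C M P Mc)

include hg

theorem chiralP_eq_zero (s : Bool) (n : ℕ) (hn : N < n) : chiralP P s n = 0 := by
  simp [chiralP, hg.Pbound n hn]

theorem span_chiral_eq_top : ⊤ ≤ Submodule.span ℂ (Set.range (Sum.elim ![H, D, C, M 0 1, Mc]
    fun p : Bool × Fin (N + 1) => chiralP P p.1 p.2)) := by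
  set v : Fin 5 ⊕ Bool × Fin (N + 1) → g := Sum.elim ![H, D, C, M 0 1, Mc]
    fun p : Bool × Fin (N + 1) => chiralP P p.1 p.2 with hv
  have hmem : ∀ i, v i ∈ Submodule.span ℂ (Set.range v) := fun i =>
    Submodule.subset_span ⟨i, rfl⟩
  have hP : ∀ s n, chiralP P s n ∈ Submodule.span ℂ (Set.range v) := by
    intro s n
    rcases le_or_gt n N with h | h
    · exact hmem (Sum.inr (s, ⟨n, Nat.lt_succ_of_le h⟩))
    · rw [hg.chiralP_eq_zero s n h]
      exact zero_mem _
  have hM : ∀ i, M i i = 0 := fun i => by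
    linear_combination (norm := module) (1 / 2 : ℂ) • hg.skewM i i
  rw [← hg.spans, Submodule.span_le]
  rintro x ((hx | ⟨i, j, rfl⟩) | ⟨n, i, rfl⟩)
  · rcases hx with rfl | rfl | rfl | rfl
    exacts [hmem (Sum.inl 0), hmem (Sum.inl 1), hmem (Sum.inl 2), hmem (Sum.inl 4)]
  · fin_cases i <;> fin_cases j
    · simp [hM]
    · exact hmem (Sum.inl 3)
    · change M 1 0 ∈ Submodule.span ℂ (Set.range v)
      rw [hg.skewM 0 1]
      exact neg_mem (hmem (Sum.inl 3))
    · simp [hM]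
  · fin_cases i
    · have h : P n 0 = (1 / 2 : ℂ) • (chiralP P true n + chiralP P false n) := by
        simp only [chiralP, chirality]
        module
      change P n 0 ∈ Submodule.span ℂ (Set.range v)
      rw [h]
      exact Submodule.smul_mem _ _ (add_mem (hP _ _) (hP _ _))
    · have h : P n 1 = (1 / (2 * Complex.I)) • (chiralP P true n - chiralP P false n) := by
        simp only [chiralP, chirality]
        match_scalars <;> field_simp <;> ring
      change P n 1 ∈ Submodule.span ℂ (Set.range v)
      rw [h]
      exact Submodule.smul_mem _ _ (sub_mem (hP _ _) (hP _ _))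

theorem exists_isChiralBasis : ∃ e : Basis (Fin 5 ⊕ Bool × Fin (N + 1)) ℂ g,
    IsChiralBasis N e H D C (M 0 1) Mc (chiralP P) fun m => 2 * bcoef N m := by
  have hcard : Fintype.card (Fin 5 ⊕ Bool × Fin (N + 1)) = finrank ℂ g := by
    rw [hg.dim]
    simp
    ring
  have he := coe_basisOfTopLeSpanOfCardEqFinrank _ hg.span_chiral_eq_top hcard
  have hk : kron (0 : Fin 2) 1 = 0 ∧ kron (1 : Fin 2) 0 = 0 ∧ kron (0 : Fin 2) 0 = 1 ∧
      kron (1 : Fin 2) 1 = 1 := by simp [kron]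
  obtain ⟨h01, h10, h00, h11⟩ := hk
  have hχ : ∀ s, chirality s * chirality s = -1 := by
    intro s
    cases s <;> simp [chirality]
  refine ⟨basisOfTopLeSpanOfCardEqFinrank _ hg.span_chiral_eq_top hcard, ?_⟩
  exact
    { e_inl := fun i => by rw [he]; rfl
      e_inr := fun p => by rw [he]; rfl
      P_eq_zero := hg.chiralP_eq_zero
      DH := hg.bDH
      CH := hg.bCH
      DC := hg.bDC
      RH := by rw [← lie_skew, hg.bHM, neg_zero]
      RD := by rw [← lie_skew, hg.bDM, neg_zero]
      RC := by rw [← lie_skew, hg.bCM, neg_zero]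
      lie_Z := hg.central
      HP_zero := fun s => by simp [chiralP, hg.bHP 0 (Nat.zero_le N)]
      HP := fun s n hn => by
        simp only [chiralP, lie_add, lie_smul, hg.bHP (n + 1) hn, Nat.add_sub_cancel]
        push_cast
        module
      DP := fun s n => by
        rcases le_or_gt n N with h | h
        · simp only [chiralP, lie_add, lie_smul, hg.bDP n h]
          module
        · rw [hg.chiralP_eq_zero s n h, lie_zero, smul_zero]
      CP := fun s n => by
        rcases le_or_gt n N with h | h
        · simp only [chiralP, lie_add, lie_smul, hg.bCP n h]
          module
        · rw [hg.chiralP_eq_zero s n h, hg.chiralP_eq_zero s _ (h.trans n.lt_succ_self),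
            lie_zero, smul_zero]
      RP := fun s n => by
        simp only [chiralP, lie_add, lie_smul, hg.bMP, h01, h10, h00, h11, smul_add, smul_smul,
          hχ]
        module
      PP := fun s t m n => by
        have h : ⁅chiralP P s m, chiralP P t n⁆ = ((1 + chirality s * chirality t) *
            (if m + n = N then bcoef N m else 0)) • Mc := by
          simp only [chiralP, lie_add, add_lie, lie_smul, smul_lie, hg.bPP, h01, h10, h00, h11]
          module
        rw [h]
        by_cases hmn : m + n = N <;> cases s <;> cases t <;> simp [chirality, hmn] <;> norm_num
      β_zero := mul_ne_zero two_ne_zero (bcoef_ne_zero N 0)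
      β_last := mul_ne_zero two_ne_zero (bcoef_ne_zero N N) }

end IsCGAHat

end Presentation

/-- For `g = ĉga_ℓ(2,ℂ)` with `ℓ ∈ 1/2 + ℕ₀`, `ℓ ≥ 3/2` (`N = 2ℓ` odd, `N ≥ 3`):
`H²(g,g) ≅ ℂ`. -/
theorem stmt18 (N : ℕ) (hN : Odd N) (hN3 : 3 ≤ N)
    {g : Type*} [LieRing g] [LieAlgebra ℂ g]
    (H D C : g) (M : Fin 2 → Fin 2 → g) (P : ℕ → Fin 2 → g) (Mc : g)
    (hg : IsCGAHat 2 N H D C M P Mc) :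
    H2Dim1 g := by
  obtain ⟨e, he⟩ := hg.exists_isChiralBasis
  exact he.h2Dim1 hN hN3
end
end
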